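/- Let k be a number field and A a finite abelian group. There exists a constant C, depending only on k and A, such that for every positive integer q and every X ≥ 2, the number N_q(A, X) of isomorphism classes of A-extensions L/k with Disc(L) ≤ X and q dividing Disc(L) satisfies N_q(A, X) ≤ O(C^{ω(q)} / q^{1/a(A)}) · X^{1/a(A)} · (ln X)^{b(k,A) − 1}, where the implied constant depends only on k and A, not on q. -/

import Mathlib

open scoped Classical NumberField

noncomputable section

local notation "kbar" k => AlgebraicClosure k

/-- The index of an element of a finite group in its regular representation on
`|A|` letters: `ind(g) = |A| - |A|/ord(g)`. -/
def ind (A : Type*) [Group A] [Fintype A] (g : A) : ℕ :=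
  Fintype.card A - Fintype.card A / orderOf g

/-- `a(A)`: the minimal index of a non-identity element of `A`. -/
def minInd (A : Type*) [Group A] [Fintype A] : ℕ :=
  sInf {n : ℕ | ∃ g : A, g ≠ 1 ∧ ind A g = n}

/-- An `A`-extension of `k`: a finite Galois subfield `L` of an algebraic closure of `k`
together with an isomorphism `Gal(L/k) ≃* A`.  Since `A` is abelian, such pairs are in
natural bijection with the isomorphism classes of `A`-extensions of `k`. -/
structure AExtension (k : Type*) [Field k] (A : Type*) [CommGroup A] where
  L : IntermediateField k (kbar k)
  fd : FiniteDimensional k L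
  gal : IsGalois k L
  ψ : (L ≃ₐ[k] L) ≃* A

/-- `Disc(L)`: the absolute norm to `ℚ` of the discriminant of `L/ℚ`
(junk value `0` in the infinite-dimensional case). -/
def absDisc (k : Type*) [Field k] [NumberField k] (K : IntermediateField k (kbar k)) : ℕ :=
  haveI : CharZero K := (algebraMap K (kbar k)).charZero
  if h : FiniteDimensional k K then
    haveI := h
    haveI : IsScalarTower ℚ k K := IsScalarTower.of_algebraMap_eq' (Subsingleton.elim _ _)
    haveI : FiniteDimensional ℚ K := Module.Finite.trans k K
    haveI : NumberField K := ⟨⟩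
    (NumberField.discr K).natAbs
  else 0

/-- The cyclotomic relation on `A` over `k`: `g'` is obtained from `g` by powering by a
value of the cyclotomic character of the absolute Galois group of `k` (an automorphism
`σ` of the algebraic closure acts on the roots of unity of order dividing the exponent of
`A` by `ζ ↦ ζ^u`, and on `A` by `g ↦ g^u`). -/
def cycRel (k : Type*) [Field k] (A : Type*) [CommGroup A] [Fintype A] (g g' : A) : Prop :=
  ∃ (σ : (kbar k) ≃ₐ[k] (kbar k)) (u : ℕ),
    (∀ ζ : kbar k, ζ ^ Monoid.exponent A = 1 → σ ζ = ζ ^ u) ∧ g' = g ^ u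

/-- `b(k, A)`: the number of orbits of the set of non-identity elements of `A` of minimal
index `a(A)` under the cyclotomic action of the absolute Galois group of `k`, counted as
the number of distinct cyclotomic orbit sets. -/
def bkA (k : Type*) [Field k] (A : Type*) [CommGroup A] [Fintype A] : ℕ :=
  Nat.card {S : Set A | ∃ g : A, g ≠ 1 ∧ ind A g = minInd A ∧ S = {g' | cycRel k A g g'}}

section

open IsDedekindDomain

/-- The weights `w i ≥ 1` have counting function `O(Z (1 + log Z) ^ b)`. -/
def LogCount {I : Type*} (w : I → ℝ) (b : ℕ) : Prop :=
  (∀ i, 1 ≤ w i) ∧ ∃ c : ℝ, 0 < c ∧ ∀ Z : ℝ, 1 ≤ Z →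
    {i | w i ≤ Z}.Finite ∧ ({i | w i ≤ Z}.ncard : ℝ) ≤ c * Z * (1 + Real.log Z) ^ b

lemma LogCount.comp_injective {I J : Type*} {w : I → ℝ} {b : ℕ} (h : LogCount w b) {f : J → I}
    (hf : Function.Injective f) : LogCount (fun j => w (f j)) b := by
  obtain ⟨h1, c, hc, h2⟩ := h
  refine ⟨fun j => h1 _, c, hc, fun Z hZ => ?_⟩
  obtain ⟨hfin, hb⟩ := h2 Z hZ
  refine ⟨hfin.preimage hf.injOn, le_trans (Nat.cast_le.2 ?_) hb⟩
  exact Set.ncard_le_ncard_of_injOn f (fun j hj => hj) hf.injOn hfin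

lemma LogCount.comp_equiv {I J : Type*} {w : I → ℝ} {b : ℕ} (h : LogCount w b) (e : J ≃ I) :
    LogCount (fun j => w (e j)) b :=
  h.comp_injective e.injective

/-- Dyadic decomposition: sums of negative powers of weights with linear counting function. -/
lemma sum_rpow_neg_le {J : Type*} {v : J → ℝ} (hv : ∀ j, 1 ≤ v j) {c : ℝ}
    (h : ∀ Z : ℝ, 1 ≤ Z → {j | v j ≤ Z}.Finite ∧ ({j | v j ≤ Z}.ncard : ℝ) ≤ c * Z)
    {s : ℝ} (hs : 0 ≤ s) (T : Finset J) (M : ℕ) (hM : ∀ j ∈ T, Nat.log 2 ⌊v j⌋₊ < M) :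
    ∑ j ∈ T, v j ^ (-s) ≤ ∑ t ∈ Finset.range M, 2 * c * ((2 : ℝ) ^ (1 - s)) ^ t := by
  rw [← Finset.sum_fiberwise_of_maps_to (t := Finset.range M) (g := fun j => Nat.log 2 ⌊v j⌋₊)
    (fun j hj => Finset.mem_range.2 (hM j hj))]
  refine Finset.sum_le_sum fun t _ => ?_
  have key : ∀ j ∈ T.filter (fun j => Nat.log 2 ⌊v j⌋₊ = t),
      v j ^ (-s) ≤ ((2 : ℝ) ^ t) ^ (-s) := by
    intro j hj
    have hj := (Finset.mem_filter.1 hj).2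
    have h0 : ⌊v j⌋₊ ≠ 0 := (Nat.floor_pos.2 (hv j)).ne'
    have h1 : 2 ^ t ≤ ⌊v j⌋₊ := by rw [← hj]; exact Nat.pow_log_le_self 2 h0
    have h2 : (2 : ℝ) ^ t ≤ v j := by
      have := (Nat.le_floor_iff (by linarith [hv j])).1 h1
      exact_mod_cast this
    exact Real.rpow_le_rpow_of_nonpos (by positivity) h2 (by linarith)
  refine (Finset.sum_le_sum key).trans ?_
  rw [Finset.sum_const, nsmul_eq_mul]
  have hcard : ((T.filter (fun j => Nat.log 2 ⌊v j⌋₊ = t)).card : ℝ) ≤ c * 2 ^ (t + 1) := by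
    obtain ⟨hf, hb⟩ := h (2 ^ (t + 1)) (one_le_pow₀ (by norm_num))
    refine le_trans ?_ hb
    rw [← Set.ncard_coe_finset]
    refine Nat.cast_le.2 (Set.ncard_le_ncard (fun j hj => ?_) hf)
    · have hj : Nat.log 2 ⌊v j⌋₊ = t := (Finset.mem_filter.1 (Finset.mem_coe.1 hj)).2
      have h1 : ⌊v j⌋₊ < 2 ^ (t + 1) := by rw [← hj]; exact Nat.lt_pow_succ_log_self (by norm_num) _
      have h2 := (Nat.floor_lt (by linarith [hv j])).1 h1
      have h3 : v j < (2 : ℝ) ^ (t + 1) := by exact_mod_cast h2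
      exact h3.le
  calc _ ≤ c * 2 ^ (t + 1) * ((2 : ℝ) ^ t) ^ (-s) := by gcongr
    _ = _ := by
      have : ((2 : ℝ) ^ (1 - s)) ^ t = 2 ^ t * ((2 : ℝ) ^ t) ^ (-s) := by
        rw [← Real.rpow_natCast ((2 : ℝ) ^ (1 - s)), ← Real.rpow_natCast (2 : ℝ) t,
          ← Real.rpow_mul (by norm_num),
          ← Real.rpow_mul (by norm_num), ← Real.rpow_add (by norm_num)]
        congr 1; ring
      rw [this]; ring

lemma LogCount.prod_of_sum_le {I J : Type*} {w : I → ℝ} {b b' : ℕ} (h : LogCount w b)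
    {v : J → ℝ} (hv : ∀ j, 1 ≤ v j) {c' : ℝ} (hc' : 0 < c')
    (hvf : ∀ Z : ℝ, 1 ≤ Z → {j | v j ≤ Z}.Finite)
    (hsum : ∀ Z : ℝ, 1 ≤ Z → ∀ T : Finset J, (∀ j ∈ T, v j ≤ Z) →
      ∑ j ∈ T, (v j)⁻¹ ≤ c' * (1 + Real.log Z) ^ b') :
    LogCount (fun x : I × J => w x.1 * v x.2) (b + b') := by
  obtain ⟨h1, c, hc, h2⟩ := h
  refine ⟨fun x => one_le_mul_of_one_le_of_one_le (h1 _) (hv _), c * c', by positivity,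
    fun Z hZ => ?_⟩
  have hfin : {x : I × J | w x.1 * v x.2 ≤ Z}.Finite := by
    refine ((h2 Z hZ).1.prod (hvf Z hZ)).subset fun x hx => ⟨?_, ?_⟩
    · exact (le_mul_of_one_le_right (by linarith [h1 x.1]) (hv x.2)).trans hx
    · exact (le_mul_of_one_le_left (by linarith [hv x.2]) (h1 x.1)).trans hx
  refine ⟨hfin, ?_⟩
  set T := (hvf Z hZ).toFinset
  have hsub : {x : I × J | w x.1 * v x.2 ≤ Z} ⊆
      ⋃ j ∈ T, (fun i => (i, j)) '' {i | w i ≤ Z / v j} := by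
    rintro ⟨i, j⟩ hx
    have hx : w i * v j ≤ Z := hx
    simp only [Set.mem_iUnion]
    have hvj : 0 < v j := by linarith [hv j]
    exact ⟨j, by simpa [T] using (le_mul_of_one_le_left hvj.le (h1 i)).trans hx,
      i, (le_div_iff₀ hvj).2 hx, rfl⟩
  have hZj : ∀ j ∈ T, 1 ≤ Z / v j := fun j hj => by
    have hvj : 0 < v j := by linarith [hv j]
    rw [le_div_iff₀ hvj, one_mul]
    simpa [T] using hj
  have hfin' : (⋃ j ∈ T, (fun i => (i, j)) '' {i | w i ≤ Z / v j}).Finite :=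
    T.finite_toSet.biUnion fun j hj => ((h2 _ (hZj j hj)).1.image _)
  have hlog : 0 ≤ Real.log Z := Real.log_nonneg hZ
  calc ({x : I × J | w x.1 * v x.2 ≤ Z}.ncard : ℝ)
      ≤ ((⋃ j ∈ T, (fun i => (i, j)) '' {i | w i ≤ Z / v j}).ncard : ℝ) := by
        exact_mod_cast Set.ncard_le_ncard hsub hfin'
    _ ≤ ∑ j ∈ T, (((fun i => (i, j)) '' {i | w i ≤ Z / v j}).ncard : ℝ) := by
        exact_mod_cast Finset.set_ncard_biUnion_le T _
    _ ≤ ∑ j ∈ T, c * Z * (1 + Real.log Z) ^ b * (v j)⁻¹ := by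
        refine Finset.sum_le_sum fun j hj => ?_
        have hfj := h2 _ (hZj j hj)
        have hvj : 0 < v j := by linarith [hv j]
        refine (Nat.cast_le.2 (Set.ncard_image_le hfj.1)).trans (hfj.2.trans ?_)
        have hl : Real.log (Z / v j) ≤ Real.log Z :=
          Real.log_le_log (by linarith [hZj j hj]) (div_le_self (by linarith) (hv j))
        have hl' : 0 ≤ Real.log (Z / v j) := Real.log_nonneg (hZj j hj)
        have : c * (Z / v j) * (1 + Real.log (Z / v j)) ^ b ≤
            c * (Z / v j) * (1 + Real.log Z) ^ b := by gcongr
        exact this.trans (le_of_eq (by field_simp))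
    _ = c * Z * (1 + Real.log Z) ^ b * ∑ j ∈ T, (v j)⁻¹ := by rw [Finset.mul_sum]
    _ ≤ c * Z * (1 + Real.log Z) ^ b * (c' * (1 + Real.log Z) ^ b') := by
        gcongr
        exact hsum Z hZ T (fun j hj => by simpa [T] using hj)
    _ = _ := by rw [pow_add]; ring

lemma LogCount.linear {J : Type*} {v : J → ℝ} (h : LogCount v 0) :
    ∃ c : ℝ, 0 < c ∧ ∀ Z : ℝ, 1 ≤ Z →
      {j | v j ≤ Z}.Finite ∧ ({j | v j ≤ Z}.ncard : ℝ) ≤ c * Z := by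
  simpa using h.2

lemma LogCount.prod {I J : Type*} {w : I → ℝ} {b : ℕ} (h : LogCount w b)
    {v : J → ℝ} (hv : LogCount v 0) :
    LogCount (fun x : I × J => w x.1 * v x.2) (b + 1) := by
  obtain ⟨c, hc, h2⟩ := hv.linear
  have hl2 : 0 < Real.log 2 := Real.log_pos (by norm_num)
  refine h.prod_of_sum_le hv.1 (c' := 2 * c * (1 + 1 / Real.log 2)) (by positivity)
    (fun Z hZ => (h2 Z hZ).1) fun Z hZ T hT => ?_
  have hlog : 0 ≤ Real.log Z := Real.log_nonneg hZ
  have := sum_rpow_neg_le hv.1 h2 (s := 1) (by norm_num) T (Nat.log 2 ⌊Z⌋₊ + 1)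
    (fun j hj => Nat.lt_succ_of_le (Nat.log_mono_right (Nat.floor_mono (hT j hj))))
  simp only [sub_self, Real.rpow_zero, one_pow, mul_one, Finset.sum_const, Finset.card_range,
    nsmul_eq_mul, Real.rpow_neg_one] at this
  refine this.trans ?_
  have h3 : (Nat.log 2 ⌊Z⌋₊ : ℝ) ≤ Real.log Z / Real.log 2 := by
    rw [le_div_iff₀ hl2, ← Real.log_pow]
    refine Real.log_le_log (by positivity) ?_
    have := Nat.pow_log_le_self 2 (x := ⌊Z⌋₊) (Nat.floor_pos.2 hZ).ne'
    have := (Nat.le_floor_iff (by linarith)).1 this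
    exact_mod_cast this
  push_cast
  have h4 : (Nat.log 2 ⌊Z⌋₊ : ℝ) + 1 ≤ (1 + 1 / Real.log 2) * (1 + Real.log Z) := by
    have : (1 + 1 / Real.log 2) * (1 + Real.log Z) =
      1 + Real.log Z / Real.log 2 + Real.log Z + 1 / Real.log 2 := by ring
    rw [this]
    have : 0 < 1 / Real.log 2 := by positivity
    linarith
  calc _ ≤ (1 + 1 / Real.log 2) * (1 + Real.log Z) * (2 * c) := by gcongr
    _ = _ := by ring

lemma LogCount.prod_rpow {I J : Type*} {w : I → ℝ} {b : ℕ} (h : LogCount w b)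
    {v : J → ℝ} (hv : LogCount v 0) {s : ℝ} (hs : 1 < s) :
    LogCount (fun x : I × J => w x.1 * v x.2 ^ s) b := by
  obtain ⟨c, hc, h2⟩ := hv.linear
  have hle : ∀ j, v j ≤ v j ^ s := fun j => Real.self_le_rpow_of_one_le (hv.1 j) hs.le
  have hr : (2 : ℝ) ^ (1 - s) < 1 := Real.rpow_lt_one_of_one_lt_of_neg (by norm_num) (by linarith)
  have hr0 : 0 < (2 : ℝ) ^ (1 - s) := by positivity
  refine h.prod_of_sum_le (b' := 0) (fun j => (hv.1 j).trans (hle j))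
    (c' := 2 * c * (1 - (2 : ℝ) ^ (1 - s))⁻¹) (by
      have : 0 < 1 - (2 : ℝ) ^ (1 - s) := by linarith
      positivity)
    (fun Z hZ => (h2 Z hZ).1.subset fun j hj => (hle j).trans hj) fun Z hZ T hT => ?_
  have := sum_rpow_neg_le hv.1 h2 (s := s) (by linarith) T (Nat.log 2 ⌊Z⌋₊ + 1)
    (fun j hj => Nat.lt_succ_of_le (Nat.log_mono_right (Nat.floor_mono ((hle j).trans (hT j hj)))))
  have h5 : ∀ j, (v j ^ s)⁻¹ = v j ^ (-s) := fun j =>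
    (Real.rpow_neg (by linarith [hv.1 j]) s).symm
  simp only [h5, pow_zero, mul_one]
  refine this.trans ?_
  rw [← Finset.mul_sum]
  gcongr
  rw [← tsum_geometric_of_lt_one hr0.le hr]
  exact (summable_geometric_of_lt_one hr0.le hr).sum_le_tsum _ (fun _ _ => by positivity)

lemma LogCount.pi_fin {J : Type*} {v : J → ℝ} (hv : LogCount v 0) (b : ℕ) :
    LogCount (fun x : Fin (b + 1) → J => ∏ i, v (x i)) b := by
  induction b with
  | zero => simpa using hv.comp_equiv (Equiv.funUnique (Fin 1) J)
  | succ b ih =>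
    have := (ih.prod hv).comp_equiv
      ((Fin.consEquiv (fun _ : Fin (b + 2) => J)).symm.trans (Equiv.prodComm _ _))
    simpa [Fin.prod_univ_succ, Fin.consEquiv, mul_comm, Fin.tail] using this

lemma LogCount.pi {ι J : Type*} [Fintype ι] [Nonempty ι] {v : J → ℝ} (hv : LogCount v 0) :
    LogCount (fun x : ι → J => ∏ i, v (x i)) (Nat.card ι - 1) := by
  obtain ⟨b, hb⟩ : ∃ b, Nat.card ι = b + 1 := ⟨_, (Nat.succ_pred_eq_of_pos Nat.card_pos).symm⟩
  let e : ι ≃ Fin (b + 1) := Finite.equivFinOfCardEq hb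
  have := (hv.pi_fin b).comp_equiv (Equiv.arrowCongr e (Equiv.refl J))
  rw [hb, Nat.add_sub_cancel]
  convert this using 2 with x
  simp only [Equiv.arrowCongr_apply, Equiv.coe_refl, Function.comp_apply, id]
  exact (Equiv.prod_comp e.symm (fun i => v (x i))).symm

lemma LogCount.prod_pi_rpow {I ι J : Type*} [Fintype ι] {w : I → ℝ} {b : ℕ} (h : LogCount w b)
    {v : J → ℝ} (hv : LogCount v 0) {s : ℝ} (hs : 1 < s) :
    LogCount (fun x : I × (ι → J) => w x.1 * ∏ i, v (x.2 i) ^ s) b := by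
  have main : ∀ r : ℕ, LogCount (fun x : I × (Fin r → J) => w x.1 * ∏ i, v (x.2 i) ^ s) b := by
    intro r
    induction r with
    | zero => simpa using h.comp_equiv (Equiv.prodUnique I (Fin 0 → J))
    | succ r ih =>
      have := (ih.prod_rpow hv hs).comp_equiv
        ((Equiv.prodCongr (Equiv.refl I) ((Fin.consEquiv (fun _ : Fin (r + 1) => J)).symm.trans
          (Equiv.prodComm _ _))).trans (Equiv.prodAssoc _ _ _).symm)
      convert this using 2 with x
      simp [Fin.prod_univ_succ, Fin.consEquiv, Fin.tail]
      ring
  let e := Fintype.equivFin ι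
  have := (main _).comp_equiv (Equiv.prodCongr (Equiv.refl I) (Equiv.arrowCongr e (Equiv.refl J)))
  convert this using 2 with x
  simp only [Equiv.prodCongr_apply, Prod.map, Equiv.arrowCongr_apply, Equiv.coe_refl,
    Function.comp_apply, id]
  congr 1
  exact (Equiv.prod_comp e.symm (fun i => v (x.2 i) ^ s)).symm

lemma logCount_ideals (K : Type*) [Field K] [NumberField K] :
    LogCount (fun I : {I : Ideal (𝓞 K) // I ≠ ⊥} => (Ideal.absNorm I.1 : ℝ)) 0 := by
  have h1 : ∀ I : {I : Ideal (𝓞 K) // I ≠ ⊥}, (1 : ℝ) ≤ Ideal.absNorm I.1 := fun I => by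
    exact_mod_cast Nat.one_le_iff_ne_zero.2 (by simpa [Ideal.absNorm_eq_zero_iff] using I.2)
  refine ⟨h1, ?_⟩
  have hfin : ∀ s : ℝ, {I : Ideal (𝓞 K) | (Ideal.absNorm I : ℝ) ≤ s}.Finite := fun s => by
    refine (Ideal.finite_setOfPred_absNorm_le (S := 𝓞 K) ⌊s⌋₊).subset fun I hI => ?_
    exact Nat.le_floor hI
  have ht := (NumberField.Ideal.tendsto_norm_le_div_atTop K).eventually
    (eventually_le_nhds (lt_add_one _))
  obtain ⟨s₀, hs₀⟩ := Filter.eventually_atTop.1 ht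
  set κ : ℝ := _ + (1 : ℝ) with hκ
  have hκ0 : 0 ≤ κ := le_trans (by positivity) (hs₀ (max s₀ 1) (le_max_left _ _))
  refine ⟨(κ + 1) * max s₀ 1, by positivity, fun Z hZ => ?_⟩
  refine ⟨(hfin Z).preimage Subtype.val_injective.injOn, ?_⟩
  have hm : 0 < max s₀ 1 * Z := by positivity
  have h2 := hs₀ (max s₀ 1 * Z)
    ((le_max_left _ _).trans (le_mul_of_one_le_right (by positivity) hZ))
  rw [div_le_iff₀ hm] at h2
  have h3 : ({I : {I : Ideal (𝓞 K) // I ≠ ⊥} | (Ideal.absNorm I.1 : ℝ) ≤ Z}.ncard : ℝ) ≤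
      Nat.card {I : Ideal (𝓞 K) // (Ideal.absNorm I : ℝ) ≤ max s₀ 1 * Z} := by
    refine Nat.cast_le.2 ?_
    refine Set.ncard_le_ncard_of_injOn
      (t := {I : Ideal (𝓞 K) | (Ideal.absNorm I : ℝ) ≤ max s₀ 1 * Z})
      Subtype.val (fun I hI => ?_)
      Subtype.val_injective.injOn (hfin _)
    have hI : (Ideal.absNorm I.1 : ℝ) ≤ Z := hI
    exact hI.trans (le_mul_of_one_le_left (by linarith) (le_max_right _ _))
  refine (h3.trans h2).trans ?_
  rw [pow_zero, mul_one, mul_assoc]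
  gcongr
  linarith

/-- The product of a finite set of primes. -/
def primeProd {R : Type*} [CommRing R] [IsDedekindDomain R] (T : Finset (HeightOneSpectrum R)) :
    Ideal R :=
  ∏ v ∈ T, v.asIdeal

lemma primeProd_ne_bot {R : Type*} [CommRing R] [IsDedekindDomain R]
    (T : Finset (HeightOneSpectrum R)) : primeProd T ≠ ⊥ := by
  rw [primeProd, ← Ideal.zero_eq_bot]
  exact Finset.prod_ne_zero_iff.2 fun v _ => v.ne_bot

lemma primeProd_injective {R : Type*} [CommRing R] [IsDedekindDomain R] :
    Function.Injective (primeProd (R := R)) := by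
  have key : ∀ (T : Finset (HeightOneSpectrum R)) v, v ∈ T ↔ v.asIdeal ∣ primeProd T := by
    refine fun T v => ⟨fun h => Finset.dvd_prod_of_mem _ h, fun h => ?_⟩
    obtain ⟨w, hw, hd⟩ := (v.prime.dvd_finsetProd_iff _).1 h
    have := (v.prime.dvd_prime_iff_associated w.prime).1 hd
    rwa [HeightOneSpectrum.ext (associated_iff_eq.1 this)]
  intro T T' h
  ext v
  rw [key, key, h]

lemma logCount_primeSets (K : Type*) [Field K] [NumberField K] :
    LogCount (fun T : Finset (HeightOneSpectrum (𝓞 K)) =>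
      ∏ v ∈ T, (Ideal.absNorm v.asIdeal : ℝ)) 0 := by
  have := (logCount_ideals K).comp_injective
    (f := fun T : Finset (HeightOneSpectrum (𝓞 K)) => ⟨primeProd T, primeProd_ne_bot T⟩)
    (fun T T' h => primeProd_injective (Subtype.ext_iff.1 h))
  convert this using 2 with T
  simp [primeProd, map_prod]

lemma orderOf_eq_of_ind_eq {A : Type*} [Group A] [Fintype A] {g g' : A}
    (h : ind A g = ind A g') : orderOf g = orderOf g' := by
  obtain ⟨c, hc⟩ := orderOf_dvd_card (x := g)
  obtain ⟨c', hc'⟩ := orderOf_dvd_card (x := g')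
  have h0 : 0 < orderOf g := orderOf_pos g
  have h0' : 0 < orderOf g' := orderOf_pos g'
  have e1 : Fintype.card A / orderOf g = c := by rw [hc, Nat.mul_div_cancel_left _ h0]
  have e2 : Fintype.card A / orderOf g' = c' := by rw [hc', Nat.mul_div_cancel_left _ h0']
  have l1 : c ≤ Fintype.card A := by rw [← e1]; exact Nat.div_le_self _ _
  have l2 : c' ≤ Fintype.card A := by rw [← e2]; exact Nat.div_le_self _ _
  have : c = c' := by
    unfold ind at h
    rw [e1, e2] at h
    omega
  subst this
  have hcpos : 0 < c := Nat.pos_of_ne_zero fun h => by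
    have : 0 < Fintype.card A := Fintype.card_pos
    simp [hc, h] at this
  exact Nat.eq_of_mul_eq_mul_right hcpos (hc.symm.trans hc')

lemma exists_ind_eq_minInd (A : Type*) [Group A] [Fintype A] [Nontrivial A] :
    ∃ g : A, g ≠ 1 ∧ ind A g = minInd A :=
  Nat.sInf_mem (s := {n : ℕ | ∃ g : A, g ≠ 1 ∧ ind A g = n})
    (let ⟨g, hg⟩ := exists_ne (1 : A); ⟨_, g, hg, rfl⟩)

lemma minInd_le_ind {A : Type*} [Group A] [Fintype A] {g : A} (hg : g ≠ 1) :
    minInd A ≤ ind A g :=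
  Nat.sInf_le ⟨g, hg, rfl⟩

lemma minInd_pos (A : Type*) [Group A] [Fintype A] [Nontrivial A] : 0 < minInd A := by
  obtain ⟨g, hg, h⟩ := exists_ind_eq_minInd A
  rw [← h, ind]
  have h1 : 1 < orderOf g := by
    have := orderOf_pos g
    have h2 : orderOf g ≠ 1 := by simpa using hg
    omega
  have := Nat.div_lt_self (Fintype.card_pos (α := A)) h1
  omega

lemma minInd_lt_ind {A : Type*} [Group A] [Fintype A] {g : A} (hg : g ≠ 1)
    (h : ind A g ≠ minInd A) : minInd A + 1 ≤ ind A g :=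
  lt_of_le_of_ne (minInd_le_ind hg) (Ne.symm h)

lemma isMaximal_of_mem_primesOver {k L : Type*} [Field k] [NumberField k] [Field L] [Algebra k L]
    (v : HeightOneSpectrum (𝓞 k)) (Q : v.asIdeal.primesOver (𝓞 L)) : Q.1.IsMaximal :=
  have := Q.2.2
  have := Q.2.1
  have := v.isMaximal
  Ideal.IsMaximal.of_liesOver_isMaximal Q.1 v.asIdeal

section

variable {k L : Type*} [Field k] [NumberField k] [Field L] [NumberField L] [Algebra k L]

/-- The contribution of the primes above `v` to the different. -/
def diffPart (L : Type*) [Field L] [NumberField L] [Algebra k L]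
    (v : HeightOneSpectrum (𝓞 k)) : Ideal (𝓞 L) :=
  letI : Fintype (v.asIdeal.primesOver (𝓞 L)) := Fintype.ofFinite _
  ∏ Q : v.asIdeal.primesOver (𝓞 L), Q.1 ^ (Q.1.ramificationIdx (𝓞 k) - 1)

lemma diffPart_dvd (v : HeightOneSpectrum (𝓞 k)) :
    diffPart L v ∣ differentIdeal (𝓞 k) (𝓞 L) := by
  let _ : Fintype (v.asIdeal.primesOver (𝓞 L)) := Fintype.ofFinite _
  refine Finset.prod_dvd_of_coprime (fun Q _ Q' _ h => ?_) fun Q _ => ?_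
  · have h1 := isMaximal_of_mem_primesOver v Q
    have h2 := isMaximal_of_mem_primesOver v Q'
    exact IsCoprime.pow (Ideal.isCoprime_of_isMaximal (fun h' => h (Subtype.ext h')))
  · have := Q.2.2
    have := Q.2.1
    have := v.isMaximal
    refine pow_sub_one_dvd_differentIdeal (𝓞 k) (p := v.asIdeal) _ _ v.ne_bot ?_
    rw [← Ideal.ramificationIdx'_eq_ramificationIdx v.asIdeal Q.1 v.ne_bot]
    exact Ideal.dvd_iff_le.2 Ideal.le_pow_ramificationIdx'

lemma isCoprime_diffPart {v v' : HeightOneSpectrum (𝓞 k)} (h : v ≠ v') :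
    IsCoprime (diffPart L v) (diffPart L v') := by
  let _ : Fintype (v.asIdeal.primesOver (𝓞 L)) := Fintype.ofFinite _
  let _ : Fintype (v'.asIdeal.primesOver (𝓞 L)) := Fintype.ofFinite _
  refine IsCoprime.prod_left fun Q _ => IsCoprime.prod_right fun Q' _ => ?_
  have h1 := isMaximal_of_mem_primesOver v Q
  have h2 := isMaximal_of_mem_primesOver v' Q'
  refine IsCoprime.pow (Ideal.isCoprime_of_isMaximal fun h' => h (HeightOneSpectrum.ext ?_))
  rw [Q.2.2.over, Q'.2.2.over, h']

lemma absNorm_dvd_diffPart (v : HeightOneSpectrum (𝓞 k)) {d : ℕ} (hd : 0 < d)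
    (h : ∀ Q : Ideal (𝓞 L), Q.IsPrime → Q.LiesOver v.asIdeal → d ≤ Q.ramificationIdx (𝓞 k)) :
    Ideal.absNorm v.asIdeal ^ (Module.finrank k L - Module.finrank k L / d) ∣
      Ideal.absNorm (diffPart L v) := by
  let _ : Fintype (v.asIdeal.primesOver (𝓞 L)) := Fintype.ofFinite _
  have hnorm : Ideal.absNorm (diffPart L v) = Ideal.absNorm v.asIdeal ^
      (∑ Q : v.asIdeal.primesOver (𝓞 L),
        Q.1.inertiaDeg (𝓞 k) * (Q.1.ramificationIdx (𝓞 k) - 1)) := by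
    rw [diffPart, map_prod, ← Finset.prod_pow_eq_pow_sum]
    refine Finset.prod_congr (by congr!) fun Q _ => ?_
    have := Q.2.2
    have := Q.2.1
    rw [map_pow, ← Ideal.absNorm_pow_inertiaDeg v.asIdeal Q.1, pow_mul]
  rw [hnorm]
  refine pow_dvd_pow _ ?_
  have hsum := Ideal.sum_ramification_inertia_eq_finrank v.asIdeal (𝓞 L)
  rw [← IsFractionRing.finrank_eq (𝓞 k) k (𝓞 L) L] at hsum
  set m := Module.finrank k L
  have h1 : ∀ Q : v.asIdeal.primesOver (𝓞 L), d ≤ Q.1.ramificationIdx (𝓞 k) :=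
    fun Q => h Q.1 Q.2.1 Q.2.2
  have h2 : ∑ Q : v.asIdeal.primesOver (𝓞 L), Q.1.inertiaDeg (𝓞 k) ≤ m / d := by
    rw [Nat.le_div_iff_mul_le hd, Finset.sum_mul, ← hsum]
    exact Finset.sum_le_sum fun Q _ => by rw [mul_comm]; exact Nat.mul_le_mul_right _ (h1 Q)
  have h3 : ∑ Q : v.asIdeal.primesOver (𝓞 L),
      Q.1.inertiaDeg (𝓞 k) * (Q.1.ramificationIdx (𝓞 k) - 1) +
      ∑ Q : v.asIdeal.primesOver (𝓞 L), Q.1.inertiaDeg (𝓞 k) = m := by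
    rw [← Finset.sum_add_distrib, ← hsum]
    refine Finset.sum_congr rfl fun Q _ => ?_
    have := h1 Q
    obtain ⟨e, he⟩ : ∃ e, Q.1.ramificationIdx (𝓞 k) = e + 1 :=
      ⟨_, (Nat.succ_pred_eq_of_pos (by omega)).symm⟩
    rw [he]; simp; ring
  omega

/-- A lower bound for the discriminant in terms of ramification indices. -/
lemma prod_absNorm_pow_dvd_discr (P : Finset (HeightOneSpectrum (𝓞 k)))
    (d : HeightOneSpectrum (𝓞 k) → ℕ) (hd : ∀ v ∈ P, 0 < d v)
    (h : ∀ v ∈ P, ∀ Q : Ideal (𝓞 L), Q.IsPrime → Q.LiesOver v.asIdeal →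
      d v ≤ Q.ramificationIdx (𝓞 k)) :
    ∏ v ∈ P, Ideal.absNorm v.asIdeal ^ (Module.finrank k L - Module.finrank k L / d v) ∣
      (NumberField.discr L).natAbs := by
  rw [NumberField.natAbs_discr_eq_absNorm_differentIdeal_mul_natAbs_discr_pow k (𝓞 k) L (𝓞 L)]
  refine Dvd.dvd.mul_right ?_ _
  have h1 : ∏ v ∈ P, diffPart L v ∣ differentIdeal (𝓞 k) (𝓞 L) :=
    Finset.prod_dvd_of_coprime (fun v _ v' _ h => isCoprime_diffPart h) fun v _ => diffPart_dvd v
  refine dvd_trans ?_ (map_dvd Ideal.absNorm h1)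
  rw [map_prod]
  exact Finset.prod_dvd_prod_of_dvd _ _ fun v hv => absNorm_dvd_diffPart v (hd v hv) (h v hv)
end

lemma valuationOfNeZero_liesOver {F N : Type*} [Field F] [NumberField F] [Field N] [NumberField N]
    [Algebra F N] (w : HeightOneSpectrum (𝓞 F)) (W : HeightOneSpectrum (𝓞 N))
    [W.asIdeal.LiesOver w.asIdeal] (x : Fˣ) :
    W.valuationOfNeZero (Units.map (algebraMap F N : F →* N) x) =
      w.valuationOfNeZero x ^ W.asIdeal.ramificationIdx (𝓞 F) := by
  rw [← WithZero.coe_inj, WithZero.coe_pow, HeightOneSpectrum.valuationOfNeZero_eq,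
    HeightOneSpectrum.valuationOfNeZero_eq,
    ← Ideal.ramificationIdx'_eq_ramificationIdx w.asIdeal W.asIdeal w.ne_bot]
  exact (HeightOneSpectrum.valuation_liesOver N w W (x : F)).symm

lemma ramificationIdx_cyclotomic {L N : Type*} [Field L] [NumberField L] [Field N] [NumberField N]
    [Algebra L N] {n : ℕ} (hn : n ≠ 0) {ζ : N} (hζ : IsPrimitiveRoot ζ n)
    (hadj : IntermediateField.adjoin L {ζ} = ⊤) (Q : Ideal (𝓞 N)) [Q.IsPrime]
    (hQ : (n : 𝓞 N) ∉ Q) (hQ0 : Q ≠ ⊥) : Q.ramificationIdx (𝓞 L) = 1 := by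
  have hζint : IsIntegral ℤ ζ := hζ.isIntegral (Nat.pos_of_ne_zero hn)
  let z : 𝓞 N := ⟨ζ, hζint⟩
  have hz : z ^ n = 1 := by
    apply NumberField.RingOfIntegers.coe_injective
    rw [map_pow, map_one]
    exact hζ.pow_eq_one
  have hadj' : Algebra.adjoin L {algebraMap (𝓞 N) N z} = ⊤ := by
    have h1 := IntermediateField.adjoin_simple_toSubalgebra_of_isAlgebraic
      (Algebra.IsAlgebraic.isAlgebraic (R := L) ζ)
    rw [hadj] at h1
    exact h1.symm.trans IntermediateField.top_toSubalgebra
  have hpos := Ideal.ramificationIdx_pos Q (𝓞 L)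
  by_contra hne
  have hmem := aeval_derivative_mem_differentIdeal (𝓞 L) L N z hadj'
  have hdvd : minpoly (𝓞 L) z ∣ (Polynomial.X ^ n - 1 : Polynomial (𝓞 L)) :=
    minpoly.isIntegrallyClosed_dvd (Algebra.IsIntegral.isIntegral z) (by simp [hz])
  obtain ⟨g, hg⟩ := hdvd
  have h2 := congrArg (fun p => Polynomial.aeval z (Polynomial.derivative p)) hg
  simp only [Polynomial.derivative_sub, Polynomial.derivative_X_pow, Polynomial.derivative_one,
    sub_zero, map_mul, Polynomial.derivative_mul, map_add, minpoly.aeval, zero_mul, add_zero,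
    map_natCast, map_pow, Polynomial.aeval_X] at h2
  have : Q.IsMaximal := Ideal.IsPrime.isMaximal inferInstance hQ0
  have hunder : (Q.under (𝓞 L)).IsMaximal := Ideal.IsMaximal.under (𝓞 L) Q
  have hu0 : Q.under (𝓞 L) ≠ ⊥ := by
    intro h
    exact hQ0 (Ideal.eq_bot_of_comap_eq_bot h)
  have h3 : Q ^ (Q.ramificationIdx (𝓞 L) - 1) ∣ differentIdeal (𝓞 L) (𝓞 N) := by
    refine pow_sub_one_dvd_differentIdeal (𝓞 L) (p := Q.under (𝓞 L)) _ _ hu0 ?_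
    rw [← Ideal.ramificationIdx'_eq_ramificationIdx (Q.under (𝓞 L)) Q hu0]
    exact Ideal.dvd_iff_le.2 Ideal.le_pow_ramificationIdx'
  have h4 : differentIdeal (𝓞 L) (𝓞 N) ≤ Q :=
    Ideal.dvd_iff_le.1 ((dvd_pow_self Q (by omega)).trans h3)
  have h5 : (n : 𝓞 N) * z ^ (n - 1) ∈ Q := by
    rw [h2]
    exact Q.mul_mem_right _ (h4 hmem)
  rcases (inferInstance : Q.IsPrime).mem_or_mem h5 with h | h
  · exact hQ h
  · have h6 := (inferInstance : Q.IsPrime).mem_of_pow_mem _ h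
    exact (inferInstance : Q.IsPrime).ne_top
      ((Ideal.eq_top_iff_one _).2 (hz ▸ Q.pow_mem_of_mem h6 n (Nat.pos_of_ne_zero hn)))

/-- If `κ` becomes an `n`-th power in `N = L(ζₙ)`, then away from `n` the ramification of `L / k`
clears the denominators of the valuations of `κ` divided by `n`. -/
lemma exists_valuation_mul_ramificationIdx {k L F N : Type*} [Field k] [NumberField k]
    [Field L] [NumberField L] [Field F] [NumberField F] [Field N] [NumberField N]
    [Algebra k L] [Algebra k F] [Algebra k N] [Algebra L N] [Algebra F N]
    [IsScalarTower k L N] [IsScalarTower k F N] [IsGalois k L]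
    {n : ℕ} (hn : n ≠ 0) {ζ : N} (hζ : IsPrimitiveRoot ζ n)
    (hadj : IntermediateField.adjoin L {ζ} = ⊤)
    (v : HeightOneSpectrum (𝓞 k)) (w : HeightOneSpectrum (𝓞 F)) [w.asIdeal.LiesOver v.asIdeal]
    (hv : (n : 𝓞 k) ∉ v.asIdeal) (κ : Fˣ) (a : Nˣ)
    (ha : a ^ n = Units.map (algebraMap F N : F →* N) κ)
    (Q : Ideal (𝓞 L)) [Q.IsPrime] [Q.LiesOver v.asIdeal] :
    ∃ z : Multiplicative ℤ, w.valuationOfNeZero κ ^ Q.ramificationIdx (𝓞 k) = z ^ n := by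
  have := v.isMaximal
  have := w.isMaximal
  obtain ⟨W', hW'⟩ := (inferInstance : Nonempty (w.asIdeal.primesOver (𝓞 N)))
  have := hW'.1
  have hover := hW'.2
  have hW0 : W' ≠ ⊥ := Ideal.ne_bot_of_liesOver_of_ne_bot w.ne_bot W'
  let W : HeightOneSpectrum (𝓞 N) := ⟨W', this, hW0⟩
  have : W.asIdeal.LiesOver w.asIdeal := hover
  have hWk : W.asIdeal.LiesOver v.asIdeal := Ideal.LiesOver.trans W.asIdeal w.asIdeal v.asIdeal
  let Q₀ := W.asIdeal.under (𝓞 L)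
  have hQ₀ : Q₀.LiesOver v.asIdeal := Ideal.LiesOver.tower_bot W.asIdeal Q₀ v.asIdeal
  have hWn : (n : 𝓞 N) ∉ W.asIdeal := by
    intro h
    apply hv
    rw [hWk.over, Ideal.mem_comap]
    simpa using h
  have e1 : W.asIdeal.ramificationIdx (𝓞 k) = Q₀.ramificationIdx (𝓞 k) := by
    rw [Ideal.ramificationIdx_tower (R := 𝓞 k) Q₀ W.asIdeal,
      ramificationIdx_cyclotomic hn hζ hadj W.asIdeal hWn W.ne_bot, mul_one]
  have e2 : Q₀.ramificationIdx (𝓞 k) = Q.ramificationIdx (𝓞 k) :=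
    Ideal.ramificationIdx_eq_of_isGaloisGroup v.asIdeal Q₀ Q (L ≃ₐ[k] L)
  have e3 : W.asIdeal.ramificationIdx (𝓞 F) ∣ Q.ramificationIdx (𝓞 k) := by
    rw [← e2, ← e1]
    exact Ideal.ramificationIdx_above_dvd w.asIdeal W.asIdeal
  obtain ⟨c, hc⟩ := e3
  refine ⟨W.valuationOfNeZero a ^ c, ?_⟩
  rw [hc, pow_mul, ← valuationOfNeZero_liesOver w W κ, ← ha, map_pow, pow_right_comm]

section

open scoped Pointwise

lemma perfectField_residueField {k : Type*} [Field k] [NumberField k] (p : Ideal (𝓞 k)) [p.IsPrime]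
    (hp : p ≠ ⊥) : PerfectField p.ResidueField := by
  have : p.IsMaximal := Ideal.IsPrime.isMaximal inferInstance hp
  have : Finite (𝓞 k ⧸ p) := Ideal.finiteQuotientOfFreeOfNeBot p hp
  have := Finite.of_surjective _ (Ideal.bijective_algebraMap_quotient_residueField p).2
  infer_instance

lemma card_stabilizer_eq_mul {k F G : Type*} [Field k] [NumberField k] [Field F] [NumberField F]
    [Algebra k F] [Group G] [Finite G] [MulSemiringAction G (𝓞 F)] [IsGaloisGroup G (𝓞 k) (𝓞 F)]
    (P : Ideal (𝓞 F)) [P.IsPrime] (hP : P ≠ ⊥) :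
    Nat.card (MulAction.stabilizer G P) = P.ramificationIdx (𝓞 k) * P.inertiaDeg (𝓞 k) := by
  have hp : P.under (𝓞 k) ≠ ⊥ := by
    intro h
    exact hP (Ideal.eq_bot_of_comap_eq_bot h)
  have := perfectField_residueField _ hp
  rw [Ideal.card_stabilizer_eq (P.under (𝓞 k)) P, Ideal.ramificationIdxIn_eq_ramificationIdx _ P G,
    Ideal.inertiaDegIn_eq_inertiaDeg _ P G]

lemma absNorm_under_eq_of_stabilizer_le {k F : Type*} [Field k] [NumberField k] [Field F]
    [NumberField F] [Algebra k F] [IsGalois k F] (H : Subgroup (F ≃ₐ[k] F))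
    (K : IntermediateField k F) [IsGaloisGroup H K F] (P : Ideal (𝓞 F)) [P.IsPrime]
    (hP : P ≠ ⊥) (hH : MulAction.stabilizer (F ≃ₐ[k] F) P ≤ H) :
    Ideal.absNorm (P.under (𝓞 K)) = Ideal.absNorm (P.under (𝓞 k)) := by
  have h1 := card_stabilizer_eq_mul (k := k) (G := F ≃ₐ[k] F) P hP
  have : IsGaloisGroup H (𝓞 K) (𝓞 F) := IsGaloisGroup.of_isFractionRing H (𝓞 K) (𝓞 F) K F
  have h2 := card_stabilizer_eq_mul (k := K) (G := H) P hP
  have h3 : Nat.card (MulAction.stabilizer H P) =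
      Nat.card (MulAction.stabilizer (F ≃ₐ[k] F) P) := by
    refine Nat.card_congr ⟨fun σ => ⟨σ.1.1, σ.2⟩, fun σ => ⟨⟨σ.1, hH σ.2⟩, σ.2⟩, ?_, ?_⟩
    · intro σ; rfl
    · intro σ; rfl
  have hQ : P.under (𝓞 K) ≠ ⊥ := fun h => hP (Ideal.eq_bot_of_comap_eq_bot h)
  rw [← Ideal.absNorm_pow_inertiaDeg (P.under (𝓞 k)) (P.under (𝓞 K))]
  have h4 := Ideal.ramificationIdx_tower (R := 𝓞 k) (P.under (𝓞 K)) P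
  have h5 := Ideal.inertiaDeg_tower (R := 𝓞 k) (P.under (𝓞 K)) P
  have e1 := Ideal.ramificationIdx_pos P (𝓞 K)
  have e2 := Ideal.inertiaDeg_pos P (𝓞 K)
  have e3 := Ideal.ramificationIdx_pos (P.under (𝓞 K)) (𝓞 k)
  have e4 := Ideal.inertiaDeg_pos (P.under (𝓞 K)) (𝓞 k)
  have : (P.under (𝓞 K)).inertiaDeg (𝓞 k) = 1 := by
    have h2 := h3.symm.trans h2
    rw [h1, h4, h5] at h2
    have h6 : (P.under (𝓞 K)).ramificationIdx (𝓞 k) * (P.under (𝓞 K)).inertiaDeg (𝓞 k) = 1 := by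
      have : 0 < P.ramificationIdx (𝓞 K) * P.inertiaDeg (𝓞 K) := by positivity
      apply Nat.eq_of_mul_eq_mul_right this
      linarith
    exact Nat.eq_one_of_mul_eq_one_left h6
  rw [this, pow_one]

lemma intValuation_smul {R G : Type*} [CommRing R] [IsDedekindDomain R] [Group G]
    [MulSemiringAction G R] (τ : G) (v w : HeightOneSpectrum R) (h : w.asIdeal = τ • v.asIdeal)
    (x : R) : w.intValuation (τ • x) = v.intValuation x := by
  have key : ∀ n : ℕ, w.intValuation (τ • x) ≤ WithZero.exp (-(n : ℤ)) ↔
      v.intValuation x ≤ WithZero.exp (-(n : ℤ)) := by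
    intro n
    rw [w.intValuation_le_pow_iff_mem, v.intValuation_le_pow_iff_mem, h, ← smul_pow',
      Ideal.smul_mem_pointwise_smul_iff]
  by_cases hx : x = 0
  · simp [hx]
  have hx' : τ • x ≠ 0 := fun h0 => hx (by
    rw [← inv_smul_smul τ x, h0, smul_zero])
  rw [w.intValuation_if_neg hx', v.intValuation_if_neg hx] at key ⊢
  exact le_antisymm ((key _).2 le_rfl) ((key _).1 le_rfl)

lemma valuation_smul {k F : Type*} [Field k] [Field F] [NumberField F] [Algebra k F]
    (τ : F ≃ₐ[k] F) (v w : HeightOneSpectrum (𝓞 F)) (h : w.asIdeal = τ • v.asIdeal)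
    (x : F) : w.valuation F (τ x) = v.valuation F x := by
  obtain ⟨a, b, hb, rfl⟩ := IsFractionRing.div_surjective (A := 𝓞 F) x
  have key : ∀ c : 𝓞 F, τ (algebraMap (𝓞 F) F c) = algebraMap (𝓞 F) F (τ • c) := fun c => rfl
  rw [map_div₀, key, key, map_div₀, map_div₀]
  simp only [HeightOneSpectrum.valuation_of_algebraMap, intValuation_smul τ v w h]

lemma valuationOfNeZero_smul {k F : Type*} [Field k] [Field F] [NumberField F] [Algebra k F]
    (τ : F ≃ₐ[k] F) (v w : HeightOneSpectrum (𝓞 F)) (h : w.asIdeal = τ • v.asIdeal)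
    (x : Fˣ) : w.valuationOfNeZero (Units.map (τ : F →* F) x) = v.valuationOfNeZero x := by
  rw [← WithZero.coe_inj, HeightOneSpectrum.valuationOfNeZero_eq,
    HeightOneSpectrum.valuationOfNeZero_eq]
  exact valuation_smul τ v w h x

end

/-- The homomorphism from the absolute Galois group attached to an `A`-extension. -/
def AExtension.toHom {k : Type*} [Field k] {A : Type*} [CommGroup A] (E : AExtension k A) :
    (AlgebraicClosure k ≃ₐ[k] AlgebraicClosure k) →* A :=
  have := E.gal
  E.ψ.toMonoidHom.comp (AlgEquiv.restrictNormalHom E.L)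

lemma AExtension.toHom_apply {k : Type*} [Field k] {A : Type*} [CommGroup A]
    (E : AExtension k A) [IsGalois k E.L] (σ : AlgebraicClosure k ≃ₐ[k] AlgebraicClosure k) :
    E.toHom σ = E.ψ (AlgEquiv.restrictNormalHom E.L σ) := rfl

lemma AExtension.toHom_eq_one_iff {k : Type*} [Field k] {A : Type*} [CommGroup A]
    (E : AExtension k A) (σ : AlgebraicClosure k ≃ₐ[k] AlgebraicClosure k) :
    E.toHom σ = 1 ↔ ∀ x ∈ E.L, σ x = x := by
  have := E.gal
  rw [E.toHom_apply, EmbeddingLike.map_eq_one_iff]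
  exact AlgEquiv.restrictNormal_eq_one_iff E.L σ

lemma mem_of_fixingSubgroup {k : Type*} [Field k] [CharZero k]
    (F : IntermediateField k (AlgebraicClosure k)) {a : AlgebraicClosure k}
    (h : ∀ σ : AlgebraicClosure k ≃ₐ[k] AlgebraicClosure k, (∀ x ∈ F, σ x = x) → σ a = a) :
    a ∈ F := by
  rw [← InfiniteGalois.fixedField_fixingSubgroup F, IntermediateField.mem_fixedField_iff]
  intro σ hσ
  exact h σ ((IntermediateField.mem_fixingSubgroup_iff F σ).1 hσ)

lemma AExtension.toHom_injective {k : Type*} [Field k] [CharZero k] {A : Type*} [CommGroup A] :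
    Function.Injective (AExtension.toHom : AExtension k A → _) := by
  intro E E' h
  have hL : E.L = E'.L := by
    apply le_antisymm
    · intro x hx
      refine mem_of_fixingSubgroup E'.L fun σ hσ => ?_
      rw [← E'.toHom_eq_one_iff, ← h, E.toHom_eq_one_iff] at hσ
      exact hσ x hx
    · intro x hx
      refine mem_of_fixingSubgroup E.L fun σ hσ => ?_
      rw [← E.toHom_eq_one_iff, h, E'.toHom_eq_one_iff] at hσ
      exact hσ x hx
  obtain ⟨L, fd, gal, ψ⟩ := E
  obtain ⟨L', fd', gal', ψ'⟩ := E'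
  subst hL
  congr
  ext τ
  obtain ⟨σ, rfl⟩ := AlgEquiv.restrictNormalHom_surjective (F := k) (K₁ := L)
    (E := AlgebraicClosure k) τ
  exact DFunLike.congr_fun h σ

section Kummer

variable {k : Type*} [Field k] {A : Type*} [CommGroup A]
  {F : IntermediateField k (AlgebraicClosure k)}

/-- `a` is an eigenvector of the absolute Galois group of `F` with character `χ ∘ φ`. -/
def IsResolvent (φ : (AlgebraicClosure k ≃ₐ[k] AlgebraicClosure k) →* A) (χ : A →* Fˣ)
    (a : AlgebraicClosure k) : Prop :=
  a ≠ 0 ∧ ∀ σ : AlgebraicClosure k ≃ₐ[k] AlgebraicClosure k, (∀ x ∈ F, σ x = x) →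
    σ a = ((χ (φ σ) : F) : AlgebraicClosure k) * a

lemma AExtension.exists_isResolvent (E : AExtension k A) (χ : A →* Fˣ) :
    ∃ a, IsResolvent E.toHom χ a ∧
      ∀ M : IntermediateField k (AlgebraicClosure k), F ≤ M → E.L ≤ M → a ∈ M := by
  have := E.gal
  have := E.fd
  let R : E.L → AlgebraicClosure k := fun x =>
    ∑ τ : E.L ≃ₐ[k] E.L, ((χ (E.ψ τ)⁻¹ : F) : AlgebraicClosure k) * (τ x : E.L)
  have hR : ∃ x, R x ≠ 0 := by
    by_contra! h
    let f : (E.L ≃ₐ[k] E.L) → (E.L →* AlgebraicClosure k) := fun τ =>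
      (algebraMap E.L (AlgebraicClosure k) : E.L →* AlgebraicClosure k).comp (τ : E.L →* E.L)
    have hf : Function.Injective f := by
      intro τ τ' h
      ext x
      exact DFunLike.congr_fun h x
    have h1 := (linearIndependent_monoidHom E.L (AlgebraicClosure k)).comp f hf
    rw [Fintype.linearIndependent_iff] at h1
    have h2 := h1 (fun τ => ((χ (E.ψ τ)⁻¹ : F) : AlgebraicClosure k)) (by
      ext x
      rw [Finset.sum_apply]
      exact h x) 1
    simp at h2
  obtain ⟨x, hx⟩ := hR
  refine ⟨R x, ⟨hx, fun σ hσ => ?_⟩, fun M hF hL => ?_⟩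
  · simp only [R, map_sum, map_mul, Finset.mul_sum]
    symm
    rw [← Equiv.sum_comp (Equiv.mulLeft (AlgEquiv.restrictNormalHom E.L σ))]
    refine Finset.sum_congr rfl fun τ _ => ?_
    rw [hσ _ (SetLike.coe_mem _), ← mul_assoc, E.toHom_apply]
    congr 1
    · simp only [Equiv.coe_mulLeft, map_mul, mul_inv]
      rw [← MulMemClass.coe_mul, ← Units.val_mul, ← map_mul, ← map_mul, mul_inv_cancel_left]
    · simp [AlgEquiv.restrictNormalHom_apply]
  · refine sum_mem fun τ _ => mul_mem (hF (SetLike.coe_mem _)) (hL (SetLike.coe_mem _))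

lemma IsResolvent.one (φ : (AlgebraicClosure k ≃ₐ[k] AlgebraicClosure k) →* A) :
    IsResolvent φ (1 : A →* Fˣ) 1 := ⟨one_ne_zero, fun σ _ => by simp⟩

lemma IsResolvent.mul {φ : (AlgebraicClosure k ≃ₐ[k] AlgebraicClosure k) →* A}
    {χ χ' : A →* Fˣ} {a a'} (h : IsResolvent φ χ a) (h' : IsResolvent φ χ' a') :
    IsResolvent φ (χ * χ') (a * a') := by
  refine ⟨mul_ne_zero h.1 h'.1, fun σ hσ => ?_⟩
  rw [map_mul, h.2 σ hσ, h'.2 σ hσ, MonoidHom.mul_apply, Units.val_mul, MulMemClass.coe_mul]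
  ring

lemma IsResolvent.div_mem [CharZero k] {φ : (AlgebraicClosure k ≃ₐ[k] AlgebraicClosure k) →* A}
    {χ : A →* Fˣ} {a a'} (h : IsResolvent φ χ a) (h' : IsResolvent φ χ a') : a / a' ∈ F := by
  refine mem_of_fixingSubgroup F fun σ hσ => ?_
  rw [map_div₀, h.2 σ hσ, h'.2 σ hσ]
  exact mul_div_mul_left _ _ (by simp)

lemma IsResolvent.pow_mem [CharZero k] {φ : (AlgebraicClosure k ≃ₐ[k] AlgebraicClosure k) →* A}
    {χ : A →* Fˣ} {a} (h : IsResolvent φ χ a) {n : ℕ} (hn : ∀ g : A, g ^ n = 1) : a ^ n ∈ F := by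
  refine mem_of_fixingSubgroup F fun σ hσ => ?_
  rw [map_pow, h.2 σ hσ, mul_pow, ← SubmonoidClass.coe_pow, ← Units.val_pow_eq_pow_val,
    ← map_pow, hn]
  simp

lemma IsResolvent.map [IsGalois k F] {φ : (AlgebraicClosure k ≃ₐ[k] AlgebraicClosure k) →* A}
    {χ : A →* Fˣ} {a} (h : IsResolvent φ χ a) (σ : AlgebraicClosure k ≃ₐ[k] AlgebraicClosure k) :
    IsResolvent φ ((Units.map (AlgEquiv.restrictNormalHom F σ : F →* F)).comp χ) (σ a) := by
  refine ⟨by simpa using h.1, fun ρ hρ => ?_⟩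
  have h1 : ∀ x ∈ F, (σ⁻¹ * ρ * σ) x = x := by
    intro x hx
    have h2 : σ x ∈ F := by
      have := AlgEquiv.restrictNormalHom_apply F σ ⟨x, hx⟩
      rw [← this]
      exact SetLike.coe_mem _
    rw [AlgEquiv.mul_apply, AlgEquiv.mul_apply, hρ _ h2]
    exact σ.symm_apply_apply x
  have h2 := h.2 _ h1
  have h3 : φ (σ⁻¹ * ρ * σ) = φ ρ := by
    rw [map_mul, map_mul, map_inv, inv_mul_cancel_comm]
  rw [h3] at h2
  have h4 := congrArg σ h2
  rw [AlgEquiv.mul_apply, AlgEquiv.mul_apply, map_mul] at h4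
  rw [show σ (σ⁻¹ (ρ (σ a))) = ρ (σ a) from σ.apply_symm_apply _] at h4
  rw [h4]
  congr 1
  exact (AlgEquiv.restrictNormalHom_apply F σ _).symm

/-- `c` is the Kummer generator (the `n`-th power of a resolvent) attached to the character `χ`. -/
def IsKummerGen (n : ℕ) (φ : (AlgebraicClosure k ≃ₐ[k] AlgebraicClosure k) →* A) (χ : A →* Fˣ)
    (c : Fˣ) : Prop :=
  ∃ a, IsResolvent φ χ a ∧ a ^ n = ((c : F) : AlgebraicClosure k)

variable {n : ℕ} {φ φ' : (AlgebraicClosure k ≃ₐ[k] AlgebraicClosure k) →* A} {χ χ' : A →* Fˣ}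

lemma IsResolvent.exists_isKummerGen [CharZero k] (hn : ∀ g : A, g ^ n = 1) {a}
    (h : IsResolvent φ χ a) :
    ∃ c : Fˣ, IsKummerGen n φ χ c ∧ a ^ n = ((c : F) : AlgebraicClosure k) := by
  have h0 : (⟨a ^ n, h.pow_mem hn⟩ : F) ≠ 0 := by
    intro h0
    exact pow_ne_zero n h.1 (congrArg Subtype.val h0)
  exact ⟨Units.mk0 _ h0, ⟨a, h, rfl⟩, rfl⟩

lemma isKummerGen_one : IsKummerGen n φ (1 : A →* Fˣ) 1 := ⟨1, IsResolvent.one φ, by simp⟩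

lemma IsKummerGen.mul {c c' : Fˣ} (h : IsKummerGen n φ χ c) (h' : IsKummerGen n φ χ' c') :
    IsKummerGen n φ (χ * χ') (c * c') := by
  obtain ⟨a, ha, hac⟩ := h
  obtain ⟨a', ha', hac'⟩ := h'
  exact ⟨a * a', ha.mul ha', by rw [mul_pow, hac, hac']; simp⟩

lemma IsKummerGen.unique [CharZero k] {c c' : Fˣ} (h : IsKummerGen n φ χ c)
    (h' : IsKummerGen n φ χ c') : ∃ y : Fˣ, c = c' * y ^ n := by
  obtain ⟨a, ha, hac⟩ := h
  obtain ⟨a', ha', hac'⟩ := h'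
  have h0 : (⟨a / a', ha.div_mem ha'⟩ : F) ≠ 0 := by
    intro h0
    exact div_ne_zero ha.1 ha'.1 (congrArg Subtype.val h0)
  refine ⟨Units.mk0 _ h0, ?_⟩
  ext
  push_cast
  rw [Units.val_mk0, ← hac, ← hac', div_pow, mul_div_cancel₀]
  exact pow_ne_zero n ha'.1

lemma IsKummerGen.map [IsGalois k F] {c : Fˣ} (h : IsKummerGen n φ χ c)
    (σ : AlgebraicClosure k ≃ₐ[k] AlgebraicClosure k) :
    IsKummerGen n φ ((Units.map (AlgEquiv.restrictNormalHom F σ : F →* F)).comp χ)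
      (Units.map (AlgEquiv.restrictNormalHom F σ : F →* F) c) := by
  obtain ⟨a, ha, hac⟩ := h
  refine ⟨σ a, ha.map σ, ?_⟩
  rw [← map_pow, hac]
  exact (AlgEquiv.restrictNormalHom_apply F σ _).symm

/-- Kummer generators agreeing up to `n`-th powers give the same restriction to `F`. -/
lemma IsKummerGen.apply_eq (hn : n ≠ 0) {ζ : F} (hζ : IsPrimitiveRoot ζ n) {c c' y : Fˣ}
    (h : IsKummerGen n φ χ c) (h' : IsKummerGen n φ' χ c') (hy : c = c' * y ^ n)
    (σ : AlgebraicClosure k ≃ₐ[k] AlgebraicClosure k) (hσ : ∀ x ∈ F, σ x = x) :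
    χ (φ σ) = χ (φ' σ) := by
  obtain ⟨a, ha, hac⟩ := h
  obtain ⟨a', ha', hac'⟩ := h'
  have : NeZero n := ⟨hn⟩
  have hy0 : ((y : F) : AlgebraicClosure k) ≠ 0 := by simp
  have h1 : (a / (a' * ((y : F) : AlgebraicClosure k))) ^ n = 1 := by
    rw [div_pow, mul_pow, hac, hac', hy, div_eq_one_iff_eq]
    · push_cast; rfl
    · rw [← hac']
      exact mul_ne_zero (pow_ne_zero _ ha'.1) (pow_ne_zero _ hy0)
  have hζ' : IsPrimitiveRoot (ζ : AlgebraicClosure k) n :=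
    hζ.map_of_injective (f := algebraMap F (AlgebraicClosure k)) (algebraMap F _).injective
  obtain ⟨i, -, hi⟩ := hζ'.eq_pow_of_pow_eq_one h1
  rw [eq_div_iff (mul_ne_zero ha'.1 hy0)] at hi
  have h2 := ha.2 σ hσ
  rw [← hi] at h2
  simp only [map_mul, map_pow, ha'.2 σ hσ, hσ _ (SetLike.coe_mem _)] at h2
  have h3 : (((χ (φ' σ) : F) : AlgebraicClosure k) - ((χ (φ σ) : F) : AlgebraicClosure k)) *
      a = 0 := by
    rw [← hi]
    linear_combination h2
  have h4 := (mul_eq_zero.1 h3).resolve_right ha.1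
  ext
  exact (sub_eq_zero.1 h4).symm

end Kummer

section LocalDatum

open scoped Pointwise

variable {k : Type*} [Field k] {A : Type*} [CommGroup A]
  {F : IntermediateField k (AlgebraicClosure k)}
  {φ φ' : (AlgebraicClosure k ≃ₐ[k] AlgebraicClosure k) →* A} {ζ : Fˣ}

lemma hasEnoughRootsOfUnity_of_isPrimitiveRoot {n : ℕ} [NeZero n] (hζ : IsPrimitiveRoot ζ n) :
    HasEnoughRootsOfUnity F n :=
  ⟨⟨(ζ : F), IsPrimitiveRoot.coe_units_iff.2 hζ⟩, inferInstance⟩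

lemma eq_of_forall_char [Finite A] (hζ : IsPrimitiveRoot ζ (Monoid.exponent A)) {g g' : A}
    (h : ∀ χ : A →* Fˣ, χ g = χ g') : g = g' := by
  have : NeZero (Monoid.exponent A) := ⟨Monoid.exponent_ne_zero_of_finite⟩
  have := hasEnoughRootsOfUnity_of_isPrimitiveRoot hζ
  exact (CommGroup.forall_apply_eq_apply_iff A).1 h

/-- The tame inertia generator of `φ` at `v`, read off from valuations of Kummer generators. -/
def IsLocalDatum [NumberField F] (ζ : Fˣ)
    (φ : (AlgebraicClosure k ≃ₐ[k] AlgebraicClosure k) →* A)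
    (v : HeightOneSpectrum (𝓞 F)) (g : A) : Prop :=
  ∀ (χ : A →* Fˣ) (c : Fˣ), IsKummerGen (Monoid.exponent A) φ χ c →
    χ g = ζ ^ Multiplicative.toAdd (v.valuationOfNeZero c)

variable [NumberField F]

lemma IsLocalDatum.exponent_dvd (hζ : IsPrimitiveRoot ζ (Monoid.exponent A))
    {v : HeightOneSpectrum (𝓞 F)} {g : A} (h : IsLocalDatum ζ φ v g)
    (h' : IsLocalDatum ζ φ' v g) {χ : A →* Fˣ} {c c' : Fˣ}
    (hc : IsKummerGen (Monoid.exponent A) φ χ c) (hc' : IsKummerGen (Monoid.exponent A) φ' χ c') :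
    ∃ z : Multiplicative ℤ, v.valuationOfNeZero (c / c') = z ^ Monoid.exponent A := by
  have h1 := (h χ c hc).symm.trans (h' χ c' hc')
  have h2 : ζ ^ Multiplicative.toAdd (v.valuationOfNeZero (c / c')) = 1 := by
    rw [map_div, toAdd_div, zpow_sub, h1, mul_inv_cancel]
  obtain ⟨z, hz⟩ := (hζ.zpow_eq_one_iff_dvd _).1 h2
  refine ⟨Multiplicative.ofAdd z, ?_⟩
  apply Multiplicative.toAdd.injective
  rw [hz]
  simp

variable [Finite A]

lemma exists_isLocalDatum [CharZero k] (hζ : IsPrimitiveRoot ζ (Monoid.exponent A))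
    (hφ : ∀ χ : A →* Fˣ, ∃ c, IsKummerGen (Monoid.exponent A) φ χ c)
    (v : HeightOneSpectrum (𝓞 F)) : ∃ g, IsLocalDatum ζ φ v g := by
  have : NeZero (Monoid.exponent A) := ⟨Monoid.exponent_ne_zero_of_finite⟩
  have := hasEnoughRootsOfUnity_of_isPrimitiveRoot hζ
  choose c hc using hφ
  have key : ∀ (χ : A →* Fˣ) (d : Fˣ), IsKummerGen (Monoid.exponent A) φ χ d →
      ζ ^ Multiplicative.toAdd (v.valuationOfNeZero d) =
        ζ ^ Multiplicative.toAdd (v.valuationOfNeZero (c χ)) := by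
    intro χ d hd
    obtain ⟨y, rfl⟩ := hd.unique (hc χ)
    rw [map_mul, toAdd_mul, zpow_add, map_pow, toAdd_pow, nsmul_eq_mul, zpow_mul,
      zpow_natCast, hζ.pow_eq_one, one_zpow, mul_one]
  let η : (A →* Fˣ) →* Fˣ :=
    { toFun := fun χ => ζ ^ Multiplicative.toAdd (v.valuationOfNeZero (c χ))
      map_one' := by
        rw [← key 1 1 isKummerGen_one]; simp
      map_mul' := fun χ χ' => by
        rw [← key _ _ ((hc χ).mul (hc χ')), map_mul, toAdd_mul, zpow_add] }
  refine ⟨CommGroup.monoidHomMonoidHomEquiv A F η, fun χ d hd => ?_⟩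
  rw [CommGroup.apply_monoidHomMonoidHomEquiv, key χ d hd]
  rfl

lemma IsLocalDatum.map [IsGalois k F] [CharZero k] (hζ : IsPrimitiveRoot ζ (Monoid.exponent A))
    (hφ : ∀ χ : A →* Fˣ, ∃ c, IsKummerGen (Monoid.exponent A) φ χ c)
    {v w : HeightOneSpectrum (𝓞 F)} {g g' : A} (h : IsLocalDatum ζ φ v g)
    (h' : IsLocalDatum ζ φ w g') (τ : F ≃ₐ[k] F) (hw : w.asIdeal = τ • v.asIdeal)
    {u : ℕ} (hu : τ ζ = (ζ : F) ^ u) : g' ^ u = g := by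
  have : NeZero (Monoid.exponent A) := ⟨Monoid.exponent_ne_zero_of_finite⟩
  refine eq_of_forall_char hζ fun χ => ?_
  obtain ⟨c, hc⟩ := hφ χ
  obtain ⟨σ, rfl⟩ := AlgEquiv.restrictNormalHom_surjective (F := k) (K₁ := F)
    (E := AlgebraicClosure k) τ
  have h1 := h' _ _ (hc.map σ)
  rw [valuationOfNeZero_smul _ v w hw, ← h χ c hc] at h1
  rw [← h1, map_pow]
  have hroot : (χ g' : F) ^ Monoid.exponent A = 1 := by
    rw [← Units.val_pow_eq_pow_val, ← map_pow, Monoid.pow_exponent_eq_one, map_one, Units.val_one]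
  obtain ⟨i, -, hi⟩ := (IsPrimitiveRoot.coe_units_iff.2 hζ).eq_pow_of_pow_eq_one hroot
  ext1
  rw [Units.val_pow_eq_pow_val, MonoidHom.comp_apply, Units.coe_map, ← hi, ← pow_mul, mul_comm,
    pow_mul, ← hu]
  exact (map_pow _ _ _).symm

/-- Ramification indices above `v` are divisible by the order of the local datum. -/
lemma IsLocalDatum.orderOf_dvd_ramificationIdx [NumberField k] [IsGalois k F]
    (hζ : IsPrimitiveRoot ζ (Monoid.exponent A))
    (hF : F = IntermediateField.adjoin k {((ζ : F) : AlgebraicClosure k)})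
    (E : AExtension k A) [NumberField E.L]
    (v : HeightOneSpectrum (𝓞 k)) (w : HeightOneSpectrum (𝓞 F)) [w.asIdeal.LiesOver v.asIdeal]
    (hv : (Monoid.exponent A : 𝓞 k) ∉ v.asIdeal) {g : A} (h : IsLocalDatum ζ E.toHom w g)
    (Q : Ideal (𝓞 E.L)) [Q.IsPrime] [Q.LiesOver v.asIdeal] :
    orderOf g ∣ Q.ramificationIdx (𝓞 k) := by
  have := E.gal
  have hne : Monoid.exponent A ≠ 0 := Monoid.exponent_ne_zero_of_finite
  let z : AlgebraicClosure k := ((ζ : F) : AlgebraicClosure k)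
  let N : IntermediateField E.L (AlgebraicClosure k) := IntermediateField.adjoin E.L {z}
  have hFN : F ≤ N.restrictScalars k := by
    rw [hF, IntermediateField.adjoin_simple_le_iff]
    exact IntermediateField.mem_adjoin_simple_self E.L z
  have hLN : E.L ≤ N.restrictScalars k := fun x hx => N.algebraMap_mem ⟨x, hx⟩
  let : Algebra F N := (IntermediateField.inclusion hFN).toRingHom.toAlgebra
  have : IsScalarTower k F N := IsScalarTower.of_algebraMap_eq fun x => rfl
  have : NumberField N := by
    have : FiniteDimensional E.L N := IntermediateField.adjoin.finiteDimensional
      (Algebra.IsIntegral.isIntegral z)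
    exact NumberField.of_module_finite E.L N
  have hz : IsPrimitiveRoot (⟨z, IntermediateField.mem_adjoin_simple_self E.L z⟩ : N)
      (Monoid.exponent A) := by
    refine IsPrimitiveRoot.of_map_of_injective (f := algebraMap N (AlgebraicClosure k)) ?_
      (algebraMap N _).injective
    exact (IsPrimitiveRoot.coe_units_iff.2 hζ).map_of_injective
      (f := algebraMap F (AlgebraicClosure k)) (algebraMap F _).injective
  have hadj : IntermediateField.adjoin E.L
      {(⟨z, IntermediateField.mem_adjoin_simple_self E.L z⟩ : N)} = ⊤ := by
    apply IntermediateField.lift_injective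
    rw [IntermediateField.lift_adjoin_simple, IntermediateField.lift_top]
  refine orderOf_dvd_of_pow_eq_one (eq_of_forall_char hζ fun χ => ?_)
  obtain ⟨a, ha, haM⟩ := E.exists_isResolvent χ
  obtain ⟨c, hc, hac⟩ := ha.exists_isKummerGen (n := Monoid.exponent A)
    (fun g => Monoid.pow_exponent_eq_one g)
  let a' : Nˣ := Units.mk0 ⟨a, haM _ hFN hLN⟩ (fun h0 => ha.1 (congrArg Subtype.val h0))
  obtain ⟨t, ht⟩ := exists_valuation_mul_ramificationIdx hne hz hadj v w hv c a'
    (by ext; exact hac) Q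
  rw [map_pow, h χ c hc, map_one, ← zpow_natCast, ← zpow_mul, mul_comm, ← nsmul_eq_mul,
    ← toAdd_pow, ht, toAdd_pow, nsmul_eq_mul, zpow_mul, zpow_natCast, hζ.pow_eq_one, one_zpow]

end LocalDatum

section

variable {k : Type*} [Field k] {A : Type*} [CommGroup A]
  {F : IntermediateField k (AlgebraicClosure k)} {ζ : Fˣ}

lemma AExtension.numberField [NumberField k] (E : AExtension k A) : NumberField E.L := by
  have := E.fd
  exact NumberField.of_module_finite k E.L

lemma AExtension.absDisc_eq [NumberField k] (E : AExtension k A) [NumberField E.L] :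
    absDisc k E.L = (NumberField.discr E.L).natAbs := by
  rw [absDisc, dif_pos E.fd]

lemma AExtension.absDisc_pos [NumberField k] (E : AExtension k A) : 0 < absDisc k E.L := by
  have := E.numberField
  rw [E.absDisc_eq]
  exact Int.natAbs_pos.2 (NumberField.discr_ne_zero _)

lemma AExtension.finrank_eq [Fintype A] (E : AExtension k A) :
    Module.finrank k E.L = Fintype.card A := by
  have := E.fd
  have := E.gal
  rw [← IsGalois.card_aut_eq_finrank, ← Nat.card_eq_fintype_card]
  exact Nat.card_congr E.ψ.toEquiv

lemma AExtension.prod_dvd_absDisc [NumberField k] [Fintype A] [NumberField F] [IsGalois k F]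
    (hζ : IsPrimitiveRoot ζ (Monoid.exponent A))
    (hF : F = IntermediateField.adjoin k {((ζ : F) : AlgebraicClosure k)})
    (E : AExtension k A) {w : HeightOneSpectrum (𝓞 k) → HeightOneSpectrum (𝓞 F)}
    (hw : ∀ v, (w v).asIdeal.LiesOver v.asIdeal) {g : HeightOneSpectrum (𝓞 F) → A}
    (hg : ∀ v, IsLocalDatum ζ E.toHom v (g v)) (P : Finset (HeightOneSpectrum (𝓞 k)))
    (hP : ∀ v ∈ P, (Monoid.exponent A : 𝓞 k) ∉ v.asIdeal) :
    ∏ v ∈ P, Ideal.absNorm v.asIdeal ^ ind A (g (w v)) ∣ absDisc k E.L := by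
  have := E.numberField
  have := E.gal
  have h := prod_absNorm_pow_dvd_discr (k := k) (L := E.L) P (fun v => orderOf (g (w v)))
    (fun v _ => orderOf_pos _) (fun v hv Q _ _ => by
      have := hw v
      refine Nat.le_of_dvd ?_ (IsLocalDatum.orderOf_dvd_ramificationIdx hζ hF E v (w v)
        (hP v hv) (hg _) Q)
      exact Ideal.ramificationIdx_pos Q (𝓞 k))
  rw [E.absDisc_eq]
  simpa only [E.finrank_eq, ind] using h

end

section Selmer

lemma Ideal.exists_eq_pow_of_dvd_count {R : Type*} [CommRing R] [IsDedekindDomain R] {I : Ideal R}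
    (hI : I ≠ 0) {n : ℕ} (hn : n ≠ 0) (h : ∀ v : HeightOneSpectrum R,
      n ∣ (Associates.mk v.asIdeal).count (Associates.mk I).factors) :
    ∃ J : Ideal R, J ≠ 0 ∧ I = J ^ n := by
  choose z hz using h
  have hfin : Function.HasFiniteMulSupport fun v : HeightOneSpectrum R => v.asIdeal ^ z v := by
    refine (Ideal.hasFiniteMulSupport hI).subset fun v hv => ?_
    rw [Function.mem_mulSupport] at hv ⊢
    rw [HeightOneSpectrum.maxPowDividing, hz, mul_comm, pow_mul]
    intro h1
    exact hv (by simpa [hn] using h1)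
  have h1 : I = (∏ᶠ v : HeightOneSpectrum R, v.asIdeal ^ z v) ^ n := by
    rw [finprod_pow hfin]
    conv_lhs => rw [← Ideal.finprod_heightOneSpectrum_factorization hI]
    refine finprod_congr fun v => ?_
    rw [HeightOneSpectrum.maxPowDividing, hz, mul_comm, pow_mul]
  refine ⟨_, ?_, h1⟩
  intro h0
  rw [h0, zero_pow hn] at h1
  exact hI h1

lemma exists_finset_mul_pow {G : Type*} [CommGroup G] [Group.FG G] {n : ℕ} (hn : n ≠ 0) :
    ∃ U : Finset G, ∀ u : G, ∃ r ∈ U, ∃ y : G, u = r * y ^ n := by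
  have hfin : Finite (G ⧸ (powMonoidHom n : G →* G).range) := by
    apply CommGroup.finite_of_fg_isMulTorsion
    intro c
    obtain ⟨u, rfl⟩ := QuotientGroup.mk_surjective c
    refine isOfFinOrder_iff_pow_eq_one.2 ⟨n, Nat.pos_of_ne_zero hn, ?_⟩
    rw [← QuotientGroup.mk_pow, QuotientGroup.eq_one_iff]
    exact ⟨u, rfl⟩
  have := Fintype.ofFinite (G ⧸ (powMonoidHom n : G →* G).range)
  refine ⟨Finset.univ.image fun c : G ⧸ (powMonoidHom n : G →* G).range => c.out, fun u => ?_⟩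
  refine ⟨_, Finset.mem_image_of_mem _ (Finset.mem_univ (QuotientGroup.mk u)), ?_⟩
  obtain ⟨y, hy⟩ := QuotientGroup.eq.1 (QuotientGroup.out_eq' (QuotientGroup.mk u :
    G ⧸ (powMonoidHom n : G →* G).range))
  exact ⟨y, by rw [← powMonoidHom_apply, hy]; simp⟩

variable (F : Type*) [Field F] [NumberField F]

/-- Finitely many classes represent, modulo `n`-th powers, all elements whose valuations are
divisible by `n`. -/
lemma exists_finset_selmer {n : ℕ} (hn : n ≠ 0) : ∃ R : Finset Fˣ, ∀ x : Fˣ,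
    (∀ v : HeightOneSpectrum (𝓞 F), ∃ z : Multiplicative ℤ, v.valuationOfNeZero x = z ^ n) →
    ∃ r ∈ R, ∃ y : Fˣ, x = r * y ^ n := by
  let P : Fˣ → ClassGroup (𝓞 F) → Prop := fun x c => ∃ (b : Fˣ) (a : 𝓞 F)
    (J : nonZeroDivisors (Ideal (𝓞 F))), (a : F) = x * b ^ n ∧
      Ideal.span {a} = (J : Ideal (𝓞 F)) ^ n ∧
      ClassGroup.mk0 J = c
  have h1 : ∀ x : Fˣ, (∀ v : HeightOneSpectrum (𝓞 F),
      ∃ z : Multiplicative ℤ, v.valuationOfNeZero x = z ^ n) → ∃ c, P x c := by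
    intro x hx
    obtain ⟨a, b, hb, hab⟩ := IsFractionRing.div_surjective (A := 𝓞 F) (x : F)
    have hb0 : b ≠ 0 := nonZeroDivisors.ne_zero hb
    have hbF : (b : F) ≠ 0 := by simpa using hb0
    have haF : ((a * b ^ (n - 1) : 𝓞 F) : F) = x * (b : F) ^ n := by
      rw [← hab]
      obtain ⟨m, rfl⟩ := Nat.exists_eq_succ_of_ne_zero hn
      simp only [map_mul, map_pow, Nat.succ_eq_add_one, Nat.add_sub_cancel, pow_succ]
      field_simp
    have ha0 : a * b ^ (n - 1) ≠ 0 := by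
      intro h0
      rw [h0] at haF
      exact mul_ne_zero x.ne_zero (pow_ne_zero n hbF) (haF.symm.trans (map_zero _))
    obtain ⟨J, hJ0, hJ⟩ := Ideal.exists_eq_pow_of_dvd_count
      (I := Ideal.span {a * b ^ (n - 1)}) (by simpa using ha0) hn (fun v => by
        obtain ⟨z, hz⟩ := hx v
        have h2 : v.valuation F ((a * b ^ (n - 1) : 𝓞 F) : F) =
            ((z * v.valuationOfNeZero (Units.mk0 (b : F) hbF) : Multiplicative ℤ) :
              WithZero (Multiplicative ℤ)) ^ n := by
          rw [haF, map_mul, map_pow, ← HeightOneSpectrum.valuationOfNeZero_eq, hz]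
          rw [WithZero.coe_mul, HeightOneSpectrum.valuationOfNeZero_eq, mul_pow, WithZero.coe_pow]
          rfl
        rw [HeightOneSpectrum.valuation_of_algebraMap, v.intValuation_if_neg ha0,
          ← WithZero.coe_pow] at h2
        have h3 := WithZero.coe_inj.1 h2
        have h4 := congrArg Multiplicative.toAdd h3
        rw [toAdd_pow, nsmul_eq_mul] at h4
        have h5 : (n : ℤ) ∣ -((Associates.mk v.asIdeal).count
            (Associates.mk (Ideal.span {a * b ^ (n - 1)})).factors : ℤ) :=
          ⟨_, h4⟩
        exact Int.natCast_dvd_natCast.1 ((dvd_neg).1 h5))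
    exact ⟨_, Units.mk0 (b : F) hbF, _, ⟨J, mem_nonZeroDivisors_of_ne_zero hJ0⟩, haF, hJ, rfl⟩
  have h2 : ∀ x x' c, P x c → P x' c → ∃ (u : (𝓞 F)ˣ) (y : Fˣ),
      x = Units.map (algebraMap (𝓞 F) F : 𝓞 F →* F) u * x' * y ^ n := by
    rintro x x' c ⟨b, a, J, hab, haJ, hJ⟩ ⟨b', a', J', hab', haJ', hJ'⟩
    obtain ⟨s, t, hs, ht, hst⟩ := ClassGroup.mk0_eq_mk0_iff.1 (hJ.trans hJ'.symm)
    have h3 : Ideal.span {t ^ n * a'} = Ideal.span {s ^ n * a} := by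
      rw [← Ideal.span_singleton_mul_span_singleton, ← Ideal.span_singleton_mul_span_singleton,
        ← Ideal.span_singleton_pow, ← Ideal.span_singleton_pow, haJ, haJ', ← mul_pow,
        ← mul_pow, hst]
    obtain ⟨u, hu⟩ := Ideal.span_singleton_eq_span_singleton.1 h3
    have hsF : (s : F) ≠ 0 := by simpa using hs
    have htF : (t : F) ≠ 0 := by simpa using ht
    refine ⟨u, Units.mk0 (t : F) htF * b' / (Units.mk0 (s : F) hsF * b), ?_⟩
    have h4 := congrArg (algebraMap (𝓞 F) F) hu
    simp only [map_mul, map_pow, hab, hab'] at h4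
    ext
    push_cast
    rw [div_pow, mul_div_assoc', eq_div_iff (by simp [hsF])]
    simp only [Units.val_mk0, Units.coe_map, mul_pow]
    refine Eq.trans ?_ (Eq.trans h4.symm ?_)
    · ring
    · change _ = algebraMap (𝓞 F) F u * _ * _
      ring
  have : Group.FG (𝓞 F)ˣ := Group.fg_iff_monoid_fg.2 inferInstance
  obtain ⟨U, hU⟩ := exists_finset_mul_pow (G := (𝓞 F)ˣ) hn
  let rep : ClassGroup (𝓞 F) → Fˣ := fun c => if h : ∃ x, P x c then h.choose else 1
  have hrep : ∀ x c, P x c → P (rep c) c := by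
    intro x c h
    have h' : ∃ x, P x c := ⟨x, h⟩
    simp only [rep, dif_pos h']
    exact h'.choose_spec
  refine ⟨(U ×ˢ Finset.univ).image fun p =>
    Units.map (algebraMap (𝓞 F) F : 𝓞 F →* F) p.1 * rep p.2, fun x hx => ?_⟩
  obtain ⟨c, hc⟩ := h1 x hx
  obtain ⟨u, y, hy⟩ := h2 x _ c hc (hrep x c hc)
  obtain ⟨r, hr, y', hy'⟩ := hU u
  refine ⟨_, Finset.mem_image_of_mem _ (Finset.mk_mem_product hr (Finset.mem_univ c)),
    Units.map (algebraMap (𝓞 F) F : 𝓞 F →* F) y' * y, ?_⟩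
  rw [hy, hy', map_mul, map_pow, mul_pow]
  simp only [mul_assoc, mul_left_comm, mul_comm]

end Selmer

section Fibers

variable {k : Type*} [Field k] {A : Type*} [CommGroup A] [Finite A]
  {F : IntermediateField k (AlgebraicClosure k)} [NumberField F] {ζ : Fˣ}

/-- An `A`-extension is determined by its local data, together with an element of a fixed
finite set. -/
lemma AExtension.exists_finite_injOn_fibers [CharZero k] [IsGalois k F]
    (hζ : IsPrimitiveRoot ζ (Monoid.exponent A))
    {dat : AExtension k A → HeightOneSpectrum (𝓞 F) → A}
    (hdat : ∀ E v, IsLocalDatum ζ E.toHom v (dat E v)) :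
    ∃ (R : Finset Fˣ) (Φ : AExtension k A → ((A →* Fˣ) → R) × ((F ≃ₐ[k] F) → A)),
      ∀ E E', dat E = dat E' → Φ E = Φ E' → E = E' := by
  set n := Monoid.exponent A with hn
  have hn0 : n ≠ 0 := Monoid.exponent_ne_zero_of_finite
  obtain ⟨R, hR⟩ := exists_finset_selmer F hn0
  have hgen : ∀ (E : AExtension k A) (χ : A →* Fˣ), ∃ c, IsKummerGen n E.toHom χ c := by
    intro E χ
    obtain ⟨a, ha, -⟩ := E.exists_isResolvent χ
    obtain ⟨c, hc, -⟩ := ha.exists_isKummerGen (n := n) (fun g => Monoid.pow_exponent_eq_one g)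
    exact ⟨c, hc⟩
  choose c hc using hgen
  have hex : ∀ D : Set.range dat, ∃ E, dat E = D := fun D => D.2
  choose rep' hrep' using hex
  let rep : AExtension k A → AExtension k A := fun E => rep' ⟨dat E, E, rfl⟩
  have hrep : ∀ E, dat (rep E) = dat E := fun E => hrep' _
  have hsel : ∀ E χ, ∃ r ∈ R, ∃ y, c E χ / c (rep E) χ = r * y ^ n := fun E χ =>
    hR _ fun v => IsLocalDatum.exponent_dvd hζ (hdat E v) (hrep E ▸ hdat (rep E) v)
      (hc E χ) (hc _ χ)
  choose r hrR y hy using hsel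
  have hsurj : Function.Surjective
      (AlgEquiv.restrictNormalHom F : (AlgebraicClosure k ≃ₐ[k] AlgebraicClosure k) →* F ≃ₐ[k] F) :=
    AlgEquiv.restrictNormalHom_surjective (F := k) (K₁ := F) (E := AlgebraicClosure k)
  choose lift hlift using hsurj
  refine ⟨R, fun E => (fun χ => ⟨r E χ, hrR E χ⟩, fun τ => E.toHom (lift τ)), ?_⟩
  intro E E' hd hΦ
  obtain ⟨h1, h2⟩ := Prod.ext_iff.1 hΦ
  have hr : ∀ χ, r E χ = r E' χ := fun χ => congrArg Subtype.val (congrFun h1 χ)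
  have hreps : rep E = rep E' := by simp only [rep, hd]
  apply AExtension.toHom_injective
  have hF : ∀ σ : AlgebraicClosure k ≃ₐ[k] AlgebraicClosure k, (∀ x ∈ F, σ x = x) →
      E.toHom σ = E'.toHom σ := by
    intro σ hσ
    refine eq_of_forall_char hζ fun χ => ?_
    refine IsKummerGen.apply_eq hn0 (ζ := (ζ : F)) (IsPrimitiveRoot.coe_units_iff.2 hζ)
      (hc E χ) (hc E' χ) (y := y E χ / y E' χ) ?_ σ hσ
    have e1 := hy E χ
    have e2 := hy E' χ
    rw [hr, hreps] at e1
    rw [div_eq_iff_eq_mul] at e1 e2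
    rw [e1, e2, div_pow, mul_right_comm, mul_right_comm _ (y E' χ ^ n), mul_assoc _ (y E' χ ^ n),
      mul_div_cancel]
  ext σ
  have h3 : AlgEquiv.restrictNormalHom F (lift (AlgEquiv.restrictNormalHom F σ)) =
    AlgEquiv.restrictNormalHom F σ := hlift _
  set σ₀ := lift (AlgEquiv.restrictNormalHom F σ) with hσ₀
  have h4 : E.toHom σ₀ = E'.toHom σ₀ := congrFun h2 _
  have h5 : E.toHom (σ₀⁻¹ * σ) = E'.toHom (σ₀⁻¹ * σ) := by
    apply hF
    intro x hx
    have h6 : AlgEquiv.restrictNormalHom F (σ₀⁻¹ * σ) = 1 := by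
      rw [map_mul, map_inv, h3, inv_mul_cancel]
    rw [← AlgEquiv.restrictNormalHom_apply F (σ₀⁻¹ * σ) ⟨x, hx⟩, h6]
    rfl
  rw [map_mul, map_mul, map_inv, map_inv, h4] at h5
  exact mul_left_cancel h5

end Fibers

section Equivariant

open scoped Pointwise

lemma eq_of_pow_eq_of_coprime_exponent {A : Type*} [CommGroup A] {u : ℕ}
    (hu : u.Coprime (Monoid.exponent A)) {g h : A} (hgh : g ^ u = h ^ u) : g = h := by
  rw [← div_eq_one, ← pow_one (g / h), ← hu.gcd_eq_one]
  exact pow_gcd_eq_one.2 ⟨by rw [div_pow, hgh, div_self'], Monoid.pow_exponent_eq_one _⟩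

variable {k F : Type*} [Field k] [Field F] [Algebra k F] {A : Type*} [CommGroup A]
  {ζ : Fˣ} {n : ℕ}

lemma coprime_of_algEquiv_apply_eq_pow [NeZero n] (hζ : IsPrimitiveRoot ζ n)
    {τ : F ≃ₐ[k] F} {u : ℕ} (hu : τ ζ = (ζ : F) ^ u) : u.Coprime n := by
  have hζ' := IsPrimitiveRoot.coe_units_iff.2 hζ
  rw [← hζ'.pow_iff_coprime (NeZero.pos n), ← hu]
  exact hζ'.map_of_injective τ.injective

lemma exists_algEquiv_apply_eq_pow [NeZero n] (hζ : IsPrimitiveRoot ζ n)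
    (τ : F ≃ₐ[k] F) : ∃ u : ℕ, τ ζ = (ζ : F) ^ u := by
  have hζ' := IsPrimitiveRoot.coe_units_iff.2 hζ
  obtain ⟨u, -, hu⟩ := hζ'.eq_pow_of_pow_eq_one (hζ'.map_of_injective τ.injective).pow_eq_one
  exact ⟨u, hu.symm⟩

variable [NumberField k] [NumberField F]

/-- Compatibility of a family of inertia generators with the Galois action on primes. -/
def IsEquivariant (k : Type*) [Field k] [Algebra k F] (ζ : Fˣ)
    (dat : HeightOneSpectrum (𝓞 F) → A) : Prop :=
  ∀ (τ : F ≃ₐ[k] F) (v w : HeightOneSpectrum (𝓞 F)) (u : ℕ), w.asIdeal = τ • v.asIdeal →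
    τ ζ = (ζ : F) ^ u → dat w ^ u = dat v

variable {dat dat' : HeightOneSpectrum (𝓞 F) → A}

lemma HeightOneSpectrum.exists_smul_eq_of_under_eq [IsGalois k F]
    {v w : HeightOneSpectrum (𝓞 F)} (h : v.under (𝓞 k) = w.under (𝓞 k)) :
    ∃ τ : F ≃ₐ[k] F, w.asIdeal = τ • v.asIdeal := by
  have : v.asIdeal.LiesOver (v.under (𝓞 k)).asIdeal := ⟨rfl⟩
  have : w.asIdeal.LiesOver (v.under (𝓞 k)).asIdeal := h ▸ ⟨rfl⟩
  obtain ⟨τ, hτ⟩ := Ideal.exists_smul_eq_of_isGaloisGroup (v.under (𝓞 k)).asIdeal v.asIdeal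
    w.asIdeal (F ≃ₐ[k] F)
  exact ⟨τ, hτ.symm⟩

variable [Finite A]

lemma IsEquivariant.eq_of_under_eq [IsGalois k F] (hζ : IsPrimitiveRoot ζ (Monoid.exponent A))
    (h : IsEquivariant k ζ dat) (h' : IsEquivariant k ζ dat') {v w : HeightOneSpectrum (𝓞 F)}
    (hvw : v.under (𝓞 k) = w.under (𝓞 k)) (hv : dat v = dat' v) : dat w = dat' w := by
  have : NeZero (Monoid.exponent A) := ⟨Monoid.exponent_ne_zero_of_finite⟩
  obtain ⟨τ, hτ⟩ := HeightOneSpectrum.exists_smul_eq_of_under_eq hvw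
  obtain ⟨u, hτu⟩ := exists_algEquiv_apply_eq_pow hζ τ
  refine eq_of_pow_eq_of_coprime_exponent (coprime_of_algEquiv_apply_eq_pow hζ hτu) ?_
  rw [h τ v w u hτ hτu, h' τ v w u hτ hτu, hv]

/-- The field over which the primes with inertia generator of order `l` split completely. -/
lemma exists_intermediateField_of_orderOf [IsGalois k F]
    (hζ : IsPrimitiveRoot ζ (Monoid.exponent A)) {l : ℕ} (hl : l ∣ Monoid.exponent A) :
    ∃ K : IntermediateField k F,
      (∀ (dat : HeightOneSpectrum (𝓞 F) → A), IsEquivariant k ζ dat → ∀ v,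
        orderOf (dat v) = l → Ideal.absNorm (v.under (𝓞 K)).asIdeal =
          Ideal.absNorm (v.under (𝓞 k)).asIdeal) ∧
      ∀ (dat dat' : HeightOneSpectrum (𝓞 F) → A), IsEquivariant k ζ dat →
        IsEquivariant k ζ dat' → ∀ v w, orderOf (dat v) = l → dat v = dat' w →
          v.under (𝓞 K) = w.under (𝓞 K) → dat' v = dat v := by
  have : NeZero (Monoid.exponent A) := ⟨Monoid.exponent_ne_zero_of_finite⟩
  obtain ⟨m, hm⟩ := hl
  have hζ' := IsPrimitiveRoot.coe_units_iff.2 hζ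
  have key : ∀ (τ : F ≃ₐ[k] F) (u : ℕ), τ ζ = (ζ : F) ^ u →
      (τ ((ζ : F) ^ m) = (ζ : F) ^ m ↔ u ≡ 1 [MOD l]) := by
    intro τ u hu
    have hm0 : m ≠ 0 := by
      rintro rfl
      exact NeZero.ne (Monoid.exponent A) hm
    rw [map_pow, hu, ← pow_mul, ← Units.val_pow_eq_pow_val, ← Units.val_pow_eq_pow_val,
      Units.val_inj, pow_eq_pow_iff_modEq, ← hζ.eq_orderOf, hm]
    refine ⟨fun h => Nat.ModEq.mul_right_cancel' hm0 (by simpa using h), fun h => ?_⟩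
    simpa using h.mul_right' m
  let H : Subgroup (F ≃ₐ[k] F) := MulAction.stabilizer (F ≃ₐ[k] F) ((ζ : F) ^ m)
  let K : IntermediateField k F := FixedPoints.intermediateField H
  have : IsGaloisGroup H (𝓞 K) (𝓞 F) := IsGaloisGroup.of_isFractionRing H (𝓞 K) (𝓞 F) K F
  refine ⟨K, fun dat hd v hv => ?_, fun dat dat' hd hd' v w hv hvw hK => ?_⟩
  · have := v.isPrime
    refine absNorm_under_eq_of_stabilizer_le H K v.asIdeal v.ne_bot fun τ hτ => ?_
    obtain ⟨u, hτu⟩ := exists_algEquiv_apply_eq_pow hζ τ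
    have h1 := hd τ v v u (MulAction.mem_stabilizer_iff.1 hτ).symm hτu
    rw [← pow_one (dat v), ← pow_mul, one_mul, pow_eq_pow_iff_modEq, hv] at h1
    exact (key τ u hτu).2 h1
  · have : v.asIdeal.LiesOver (v.under (𝓞 K)).asIdeal := ⟨rfl⟩
    have : w.asIdeal.LiesOver (v.under (𝓞 K)).asIdeal := hK ▸ ⟨rfl⟩
    obtain ⟨σ, hσ⟩ := Ideal.exists_smul_eq_of_isGaloisGroup (v.under (𝓞 K)).asIdeal v.asIdeal
      w.asIdeal H
    obtain ⟨u, hσu⟩ := exists_algEquiv_apply_eq_pow hζ (σ : F ≃ₐ[k] F)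
    have h1 := (key _ u hσu).1 σ.2
    rw [← hd' σ v w u hσ.symm hσu, ← hvw]
    conv_rhs => rw [← pow_one (dat v)]
    rwa [pow_eq_pow_iff_modEq, hv]

end Equivariant

section

open scoped Pointwise

variable {k : Type*} [Field k] [NumberField k] {A : Type*} [CommGroup A] [Fintype A]
  {F : IntermediateField k (AlgebraicClosure k)} [NumberField F] [IsGalois k F] {ζ : Fˣ}

lemma IsEquivariant.exists_of_cycRel (hζ : IsPrimitiveRoot ζ (Monoid.exponent A))
    {dat : HeightOneSpectrum (𝓞 F) → A} (h : IsEquivariant k ζ dat)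
    {v : HeightOneSpectrum (𝓞 F)} {g : A} (hg : cycRel k A g (dat v)) :
    ∃ w : HeightOneSpectrum (𝓞 F), w.under (𝓞 k) = v.under (𝓞 k) ∧ dat w = g := by
  have : NeZero (Monoid.exponent A) := ⟨Monoid.exponent_ne_zero_of_finite⟩
  obtain ⟨σ, u, hσ, hu⟩ := hg
  let τ := AlgEquiv.restrictNormalHom F σ
  have hτ : τ ζ = (ζ : F) ^ u := by
    apply Subtype.ext
    rw [AlgEquiv.restrictNormalHom_apply F σ (ζ : F), hσ]
    · rfl
    · simpa using congrArg (fun x : Fˣ => ((x : F) : AlgebraicClosure k)) hζ.pow_eq_one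
  have := v.isPrime
  let w : HeightOneSpectrum (𝓞 F) := ⟨τ • v.asIdeal, inferInstance, fun h0 => v.ne_bot (by
    simpa using congrArg (τ⁻¹ • ·) h0)⟩
  refine ⟨w, ?_, ?_⟩
  · apply HeightOneSpectrum.ext
    have : v.asIdeal.LiesOver (v.under (𝓞 k)).asIdeal := ⟨rfl⟩
    have h2 : (τ • v.asIdeal).LiesOver (v.under (𝓞 k)).asIdeal := inferInstance
    exact (h2.over).symm
  · refine eq_of_pow_eq_of_coprime_exponent (coprime_of_algEquiv_apply_eq_pow hζ hτ) ?_
    rw [h τ v w u rfl hτ, hu]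

end

section Classification

variable (k : Type*) [Field k] (A : Type*) [CommGroup A] [Fintype A]

lemma cycRel_self (g : A) : cycRel k A g g := ⟨1, 1, by simp, by simp⟩

/-- The cyclotomic orbits of elements of minimal index. -/
abbrev MinOrbit : Type _ :=
  {S : Set A | ∃ g : A, g ≠ 1 ∧ ind A g = minInd A ∧ S = {g' | cycRel k A g g'}}

/-- The non-identity elements of non-minimal index. -/
abbrev NonMinElement : Type _ := {g : A // g ≠ 1 ∧ ind A g ≠ minInd A}

/-- The type of an inertia generator: trivial, of minimal index in a given orbit, or other. -/
def inertiaType (g : A) : Option (MinOrbit k A ⊕ NonMinElement A) :=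
  if h : g = 1 then none
  else if h' : ind A g = minInd A then some (Sum.inl ⟨{g' | cycRel k A g g'}, g, h, h', rfl⟩)
  else some (Sum.inr ⟨g, h, h'⟩)

variable {k A} {g : A}

/-- A chosen representative of an orbit. -/
def MinOrbit.rep (S : MinOrbit k A) : A := S.2.choose

lemma MinOrbit.ind_rep (S : MinOrbit k A) : ind A S.rep = minInd A := S.2.choose_spec.2.1

lemma inertiaType_eq_none : inertiaType k A g = none ↔ g = 1 := by
  unfold inertiaType
  split_ifs <;> simp [*]

lemma eq_of_inertiaType_eq_inr {h : NonMinElement A}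
    (hg : inertiaType k A g = some (Sum.inr h)) : g = h := by
  unfold inertiaType at hg
  split_ifs at hg
  · cases hg
  · cases hg
    rfl

lemma ind_of_inertiaType_eq_inl {S : MinOrbit k A}
    (hg : inertiaType k A g = some (Sum.inl S)) : ind A g = minInd A := by
  unfold inertiaType at hg
  split_ifs at hg
  · assumption
  · cases hg

lemma cycRel_rep_of_inertiaType_eq_inl {S : MinOrbit k A}
    (hg : inertiaType k A g = some (Sum.inl S)) : cycRel k A S.rep g := by
  unfold inertiaType at hg
  split_ifs at hg
  · have h1 : g ∈ (S : Set A) := by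
      cases hg
      exact cycRel_self k A g
    rw [S.2.choose_spec.2.2] at h1
    exact h1
  · cases hg

end Classification

section Code

variable {V B U A O N : Type*} {π : B → V} {ρ : B → U} {w₀ : V → B}
  {cl : A → Option (O ⊕ N)} {o : O → A} {dat dat' : B → A} {NV : V → ℕ} {NU : U → ℕ}
  {e : A → ℕ} {a : ℕ}

lemma exists_code [Fintype O] [Fintype N] (hρ : ∀ b b', ρ b = ρ b' → π b = π b')
    (hpick : ∀ v S, cl (dat (w₀ v)) = some (Sum.inl S) → ∃ b, π b = v ∧ dat b = o S)
    (hN : ∀ b S, dat b = o S → NU (ρ b) = NV (π b)) (hNV : ∀ v, 1 ≤ NV v)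
    (he1 : ∀ g S, cl g = some (Sum.inl S) → a ≤ e g)
    (he2 : ∀ g h, cl g = some (Sum.inr h) → a + 1 ≤ e g) (P : Finset V) :
    ∃ (x : O → Finset U) (y : N → Finset V),
      (∀ S, ∀ u ∈ x S, ∃ b, ρ b = u ∧ dat b = o S) ∧
      (∀ v ∈ P, ∀ S, cl (dat (w₀ v)) = some (Sum.inl S) →
        ∃ b, π b = v ∧ dat b = o S ∧ ρ b ∈ x S) ∧
      (∀ h v, v ∈ y h ↔ v ∈ P ∧ cl (dat (w₀ v)) = some (Sum.inr h)) ∧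
      (∏ S, ∏ u ∈ x S, NU u) ^ a * (∏ h, ∏ v ∈ y h, NV v) ^ (a + 1) ≤
        ∏ v ∈ P, NV v ^ e (dat (w₀ v)) := by
  have hpick' : ∀ v S, ∃ b, cl (dat (w₀ v)) = some (Sum.inl S) → π b = v ∧ dat b = o S := by
    intro v S
    by_cases h : cl (dat (w₀ v)) = some (Sum.inl S)
    · exact (hpick v S h).imp fun b hb _ => hb
    · exact ⟨w₀ v, fun h' => absurd h' h⟩
  choose pick hpick' using hpick'
  have hπ := fun v S h => (hpick' v S h).1
  have ho := fun v S h => (hpick' v S h).2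
  let Q : Option (O ⊕ N) → Finset V := fun c => P.filter fun v => cl (dat (w₀ v)) = c
  have hQ : ∀ c, ∀ v ∈ Q c, v ∈ P ∧ cl (dat (w₀ v)) = c := fun c v hv => Finset.mem_filter.1 hv
  refine ⟨fun S => (Q (some (Sum.inl S))).image fun v => ρ (pick v S),
    fun h => Q (some (Sum.inr h)), ?_, ?_, ?_, ?_⟩
  · intro S u hu
    obtain ⟨v, hv, rfl⟩ := Finset.mem_image.1 hu
    exact ⟨_, rfl, ho _ _ (hQ _ v hv).2⟩
  · intro v hv S hS
    exact ⟨pick v S, hπ _ _ hS, ho _ _ hS,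
      Finset.mem_image_of_mem _ (Finset.mem_filter.2 ⟨hv, hS⟩)⟩
  · intro h v
    simp [Q]
  · have hx : ∀ S, ∏ u ∈ (Q (some (Sum.inl S))).image (fun v => ρ (pick v S)), NU u =
        ∏ v ∈ Q (some (Sum.inl S)), NV v := by
      intro S
      rw [Finset.prod_image]
      · refine Finset.prod_congr rfl fun v hv => ?_
        rw [hN _ S (ho _ _ (hQ _ v hv).2), hπ _ _ (hQ _ v hv).2]
      · intro v hv v' hv' hvv
        have := hρ _ _ hvv
        rwa [hπ _ _ (hQ _ v hv).2, hπ _ _ (hQ _ v' hv').2] at this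
    rw [← Finset.prod_fiberwise P (fun v => cl (dat (w₀ v))), Fintype.prod_option,
      Fintype.prod_sum_type]
    simp only [hx, ← Finset.prod_pow]
    refine le_trans ?_ (Nat.le_mul_of_pos_left _
      (Finset.prod_pos fun v _ => pow_pos (hNV v) _))
    refine Nat.mul_le_mul ?_ ?_
    · refine Finset.prod_le_prod' fun S _ => Finset.prod_le_prod' fun v hv => ?_
      exact Nat.pow_le_pow_right (hNV v) (he1 _ S (hQ _ v hv).2)
    · refine Finset.prod_le_prod' fun h _ => Finset.prod_le_prod' fun v hv => ?_
      exact Nat.pow_le_pow_right (hNV v) (he2 _ h (hQ _ v hv).2)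

lemma eq_of_code [One A] (hcl : ∀ g, cl g = none → g = 1)
    (hcl' : ∀ g g' h, cl g = some (Sum.inr h) →
      cl g' = some (Sum.inr h) → g' = g) (hw₀ : ∀ v, π (w₀ v) = v)
    (hK : ∀ b b' S, dat b = o S → dat' b' = o S → ρ b = ρ b' → dat' b = o S)
    (hπ : ∀ b b', π b = π b' → dat' b = dat b → dat' b' = dat b')
    {x : O → Finset U} {y : N → Finset V}
    (hx' : ∀ S, ∀ u ∈ x S, ∃ b, ρ b = u ∧ dat' b = o S)
    {v : V} (hx : ∀ S, cl (dat (w₀ v)) = some (Sum.inl S) →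
      ∃ b, π b = v ∧ dat b = o S ∧ ρ b ∈ x S)
    (hy : ∀ h, cl (dat (w₀ v)) = some (Sum.inr h) → v ∈ y h)
    (hy' : ∀ h, v ∈ y h → cl (dat' (w₀ v)) = some (Sum.inr h)) (hv : dat (w₀ v) ≠ 1) :
    dat' (w₀ v) = dat (w₀ v) := by
  rcases hc : cl (dat (w₀ v)) with _ | S | h
  · exact absurd (hcl _ hc) hv
  · obtain ⟨b, hb, hbo, hbx⟩ := hx S hc
    obtain ⟨b', hb', hbo'⟩ := hx' S _ hbx
    refine hπ b _ (hb.trans (hw₀ v).symm) ?_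
    rw [hbo, hK b b' S hbo hbo' hb'.symm]
  · exact hcl' _ _ h hc (hy' h (hy h hc))

end Code

section Primes

variable (k : Type*) [Field k] [NumberField k]

lemma two_le_absNorm {k : Type*} [Field k] [NumberField k] (v : HeightOneSpectrum (𝓞 k)) :
    2 ≤ Ideal.absNorm v.asIdeal := by
  have h0 : Ideal.absNorm v.asIdeal ≠ 0 := by
    simpa [Ideal.absNorm_eq_zero_iff] using v.ne_bot
  have h1 : Ideal.absNorm v.asIdeal ≠ 1 := by
    simpa [Ideal.absNorm_eq_one_iff] using v.isPrime.ne_top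
  omega

lemma finite_setOf_natCast_mem {N : ℕ} (hN : N ≠ 0) :
    {v : HeightOneSpectrum (𝓞 k) | (N : 𝓞 k) ∈ v.asIdeal}.Finite := by
  have h : Ideal.span {(N : 𝓞 k)} ≠ 0 := by
    simpa [Ideal.span_singleton_eq_bot] using hN
  refine (Ideal.finite_factors h).subset fun v hv => ?_
  exact Ideal.dvd_span_singleton.2 hv

lemma card_le_finrank_of_prime_mem {p : ℕ} (hp : p.Prime)
    (T : Finset (HeightOneSpectrum (𝓞 k))) (hT : ∀ v ∈ T, (p : 𝓞 k) ∈ v.asIdeal) :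
    T.card ≤ Module.finrank ℚ k := by
  have hdvd : ∏ v ∈ T, v.asIdeal ∣ Ideal.span {(p : 𝓞 k)} := by
    have := Finset.prod_primes_dvd (s := T.image HeightOneSpectrum.asIdeal)
      (Ideal.span {(p : 𝓞 k)}) (by simp +contextual [HeightOneSpectrum.prime])
      (by simpa [Ideal.dvd_span_singleton] using hT)
    rwa [Finset.prod_image fun v _ w _ h => HeightOneSpectrum.ext h] at this
  have hnorm : Ideal.absNorm (Ideal.span {(p : 𝓞 k)}) = p ^ Module.finrank ℚ k := by
    rw [Ideal.absNorm_span_singleton, ← NumberField.RingOfIntegers.rank k,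
      Module.finrank_eq_card_chooseBasisIndex]
    simpa using congrArg Int.natAbs (Algebra.norm_algebraMap_of_basis
      (NumberField.RingOfIntegers.basis k) (p : ℤ))
  have hv : ∀ v ∈ T, p ≤ Ideal.absNorm v.asIdeal := by
    intro v hv
    have h1 : Ideal.absNorm v.asIdeal ∣ p ^ Module.finrank ℚ k := by
      rw [← hnorm]
      exact Ideal.absNorm_dvd_absNorm_of_le ((Ideal.span_singleton_le_iff_mem _).2 (hT v hv))
    obtain ⟨f, -, hf⟩ := (Nat.dvd_prime_pow hp).1 h1
    have h2 := two_le_absNorm v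
    rw [hf] at h2 ⊢
    refine Nat.le_self_pow ?_ p
    rintro rfl
    simp at h2
  have h1 : p ^ T.card ≤ p ^ Module.finrank ℚ k := by
    rw [← hnorm]
    refine le_trans ?_ (Nat.le_of_dvd ?_ (map_dvd Ideal.absNorm hdvd))
    · rw [map_prod]
      exact Finset.pow_card_le_prod _ _ _ hv
    · rw [hnorm]
      exact pow_pos hp.pos _
  exact (Nat.pow_le_pow_iff_right hp.one_lt).1 h1

lemma ncard_setOf_natCast_mem_le {N : ℕ} (hN : N ≠ 0) :
    {v : HeightOneSpectrum (𝓞 k) | (N : 𝓞 k) ∈ v.asIdeal}.ncard ≤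
      Module.finrank ℚ k * N.primeFactors.card := by
  have hsub : {v : HeightOneSpectrum (𝓞 k) | (N : 𝓞 k) ∈ v.asIdeal} ⊆
      ⋃ p ∈ N.primeFactors, {v : HeightOneSpectrum (𝓞 k) | (p : 𝓞 k) ∈ v.asIdeal} := by
    intro v hv
    have h1 : (N : 𝓞 k) = ∏ p ∈ N.primeFactors, (p : 𝓞 k) ^ N.factorization p := by
      conv_lhs => rw [← Nat.prod_factorization_pow_eq_self hN]
      simp [Finsupp.prod]
    have h2 : (N : 𝓞 k) ∈ v.asIdeal := hv
    rw [h1, v.isPrime.prod_mem_iff] at h2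
    obtain ⟨p, hp, h3⟩ := h2
    exact Set.mem_biUnion hp (v.isPrime.mem_of_pow_mem _ h3)
  have hfin : ∀ p ∈ N.primeFactors,
      {v : HeightOneSpectrum (𝓞 k) | (p : 𝓞 k) ∈ v.asIdeal}.Finite := fun p hp =>
    finite_setOf_natCast_mem k (Nat.prime_of_mem_primeFactors hp).ne_zero
  refine (Set.ncard_le_ncard hsub (N.primeFactors.finite_toSet.biUnion hfin)).trans ?_
  refine (Finset.set_ncard_biUnion_le _ _).trans ?_
  rw [mul_comm, ← smul_eq_mul]
  refine Finset.sum_le_card_nsmul _ _ _ fun p hp => ?_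
  rw [Set.ncard_eq_toFinset_card _ (hfin p hp)]
  exact card_le_finrank_of_prime_mem k (Nat.prime_of_mem_primeFactors hp) _ (by simp)

end Primes

section

variable {k : Type*} [Field k] [NumberField k]

lemma coprime_absNorm_of_notMem {q : ℕ} {v : HeightOneSpectrum (𝓞 k)}
    (hv : (q : 𝓞 k) ∉ v.asIdeal) : q.Coprime (Ideal.absNorm v.asIdeal) := by
  have : Finite (𝓞 k ⧸ v.asIdeal) := Ideal.finiteQuotientOfFreeOfNeBot _ v.ne_bot
  have := v.isPrime
  refine Nat.Coprime.symm (Nat.coprime_of_dvd fun p hp h1 h2 => ?_)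
  have : Fact p.Prime := ⟨hp⟩
  rw [Ideal.absNorm_apply, Submodule.cardQuot_apply] at h1
  obtain ⟨x, hx⟩ := exists_prime_addOrderOf_dvd_card' p h1
  have h3 : q • x = 0 := addOrderOf_dvd_iff_nsmul_eq_zero.1 (hx ▸ h2)
  rw [nsmul_eq_mul, mul_eq_zero] at h3
  rcases h3 with h3 | h3
  · exact hv (Ideal.Quotient.eq_zero_iff_mem.1 (by simpa using h3))
  · rw [h3, addOrderOf_zero] at hx
    exact hp.one_lt.ne hx

variable {A : Type*} [CommGroup A] [Fintype A]
  {F : IntermediateField k (AlgebraicClosure k)} [NumberField F] {K : IntermediateField k F}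
  {w₀ : HeightOneSpectrum (𝓞 k) → HeightOneSpectrum (𝓞 F)}
  {Exc : Set (HeightOneSpectrum (𝓞 k))} {dat dat' : HeightOneSpectrum (𝓞 F) → A}
  {x : MinOrbit k A → Finset (HeightOneSpectrum (𝓞 K))}
  {y : NonMinElement A → Finset (HeightOneSpectrum (𝓞 k))} {ζ : Fˣ}

/-- The finite sets of primes `x` and `y` encode the family of inertia generators `dat` at the
primes outside `Exc`. -/
structure IsCode (w₀ : HeightOneSpectrum (𝓞 k) → HeightOneSpectrum (𝓞 F))
    (Exc : Set (HeightOneSpectrum (𝓞 k))) (dat : HeightOneSpectrum (𝓞 F) → A)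
    (x : MinOrbit k A → Finset (HeightOneSpectrum (𝓞 K)))
    (y : NonMinElement A → Finset (HeightOneSpectrum (𝓞 k))) : Prop where
  exists_of_mem : ∀ S, ∀ u ∈ x S, ∃ b : HeightOneSpectrum (𝓞 F),
    b.under (𝓞 K) = u ∧ dat b = S.rep
  exists_mem : ∀ v ∉ Exc, ∀ S, inertiaType k A (dat (w₀ v)) = some (Sum.inl S) →
    ∃ b : HeightOneSpectrum (𝓞 F), b.under (𝓞 k) = v ∧ dat b = S.rep ∧ b.under (𝓞 K) ∈ x S
  mem_iff : ∀ h v, v ∈ y h ↔ v ∉ Exc ∧ inertiaType k A (dat (w₀ v)) = some (Sum.inr h)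

lemma IsCode.apply_eq [IsGalois k F] (hζ : IsPrimitiveRoot ζ (Monoid.exponent A))
    (hK : ∀ b b' S, dat b = MinOrbit.rep (k := k) S → dat' b' = MinOrbit.rep (k := k) S →
      b.under (𝓞 K) = b'.under (𝓞 K) → dat' b = MinOrbit.rep (k := k) S)
    (hw₀ : ∀ v, (w₀ v).under (𝓞 k) = v)
    (hd : IsEquivariant k ζ dat) (hd' : IsEquivariant k ζ dat')
    (h : IsCode w₀ Exc dat x y) (h' : IsCode w₀ Exc dat' x y)
    {v : HeightOneSpectrum (𝓞 k)} (hv : v ∉ Exc) (hv1 : dat (w₀ v) ≠ 1) :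
    dat' (w₀ v) = dat (w₀ v) := by
  refine eq_of_code (cl := inertiaType k A) (π := fun b : HeightOneSpectrum (𝓞 F) => b.under (𝓞 k))
    (ρ := fun b : HeightOneSpectrum (𝓞 F) => b.under (𝓞 K)) (fun g => inertiaType_eq_none.1)
    (fun g g' h hg hg' => (eq_of_inertiaType_eq_inr hg').trans (eq_of_inertiaType_eq_inr hg).symm)
    hw₀ hK (fun b b' hbb hb => hd'.eq_of_under_eq hζ hd hbb hb) h'.exists_of_mem
    (h.exists_mem v hv) (fun g hg => (h.mem_iff g v).2 ⟨hv, hg⟩)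
    (fun g hg => ((h'.mem_iff g v).1 hg).2) hv1

lemma IsCode.eq [IsGalois k F] (hζ : IsPrimitiveRoot ζ (Monoid.exponent A))
    (hK : ∀ dat dat' : HeightOneSpectrum (𝓞 F) → A, IsEquivariant k ζ dat →
      IsEquivariant k ζ dat' → ∀ b b' S, dat b = MinOrbit.rep (k := k) S →
      dat' b' = MinOrbit.rep (k := k) S →
      b.under (𝓞 K) = b'.under (𝓞 K) → dat' b = MinOrbit.rep (k := k) S)
    (hw₀ : ∀ v, (w₀ v).under (𝓞 k) = v)
    (hd : IsEquivariant k ζ dat) (hd' : IsEquivariant k ζ dat')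
    (h : IsCode w₀ Exc dat x y) (h' : IsCode w₀ Exc dat' x y)
    (hE : ∀ v ∈ Exc, dat (w₀ v) = dat' (w₀ v)) : dat = dat' := by
  have key : ∀ v, dat (w₀ v) = dat' (w₀ v) := by
    intro v
    by_cases hv : v ∈ Exc
    · exact hE v hv
    by_cases h1 : dat (w₀ v) = 1
    · by_cases h1' : dat' (w₀ v) = 1
      · rw [h1, h1']
      · exact IsCode.apply_eq hζ (hK _ _ hd' hd) hw₀ hd' hd h' h hv h1'
    · exact (IsCode.apply_eq hζ (hK _ _ hd hd') hw₀ hd hd' h h' hv h1).symm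
  funext b
  exact hd.eq_of_under_eq hζ hd' (hw₀ (b.under (𝓞 k))) (key _)

/-- The local data of an `A`-extension outside a set `Exc` can be encoded by finite sets of primes
of controlled norm. -/
lemma AExtension.exists_isCode [Nontrivial A] [IsGalois k F]
    (hζ : IsPrimitiveRoot ζ (Monoid.exponent A))
    (hF : F = IntermediateField.adjoin k {((ζ : F) : AlgebraicClosure k)})
    (hN : ∀ b S, dat b = MinOrbit.rep (k := k) S → Ideal.absNorm (b.under (𝓞 K)).asIdeal =
      Ideal.absNorm (b.under (𝓞 k)).asIdeal)
    (hw₀ : ∀ v, (w₀ v).under (𝓞 k) = v) (hd : IsEquivariant k ζ dat)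
    (E : AExtension k A) (hdat : ∀ v, IsLocalDatum ζ E.toHom v (dat v))
    {q : ℕ} (hq : q ∣ absDisc k E.L) :
    ∃ (x : MinOrbit k A → Finset (HeightOneSpectrum (𝓞 K)))
      (y : NonMinElement A → Finset (HeightOneSpectrum (𝓞 k))),
      IsCode w₀ {v | ((Monoid.exponent A * q : ℕ) : 𝓞 k) ∈ v.asIdeal} dat x y ∧
      q * ((∏ S, ∏ u ∈ x S, Ideal.absNorm u.asIdeal) ^ minInd A *
        (∏ h, ∏ v ∈ y h, Ideal.absNorm v.asIdeal) ^ (minInd A + 1)) ≤ absDisc k E.L := by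
  set Exc := {v : HeightOneSpectrum (𝓞 k) | ((Monoid.exponent A * q : ℕ) : 𝓞 k) ∈ v.asIdeal}
    with hExc
  have hv1 : ∀ v ∉ Exc, (Monoid.exponent A : 𝓞 k) ∉ v.asIdeal := by
    intro v hv h
    refine hv ?_
    simp only [hExc, Set.mem_ofPred_eq, Nat.cast_mul]
    exact v.asIdeal.mul_mem_right _ h
  have hv2 : ∀ v ∉ Exc, (q : 𝓞 k) ∉ v.asIdeal := by
    intro v hv h
    refine hv ?_
    simp only [hExc, Set.mem_ofPred_eq, Nat.cast_mul]
    exact v.asIdeal.mul_mem_left _ h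
  have hdvd : ∀ P : Finset (HeightOneSpectrum (𝓞 k)), (∀ v ∈ P, v ∉ Exc) →
      ∏ v ∈ P, Ideal.absNorm v.asIdeal ^ ind A (dat (w₀ v)) ∣ absDisc k E.L := fun P hP =>
    E.prod_dvd_absDisc hζ hF (fun v => ⟨(congrArg HeightOneSpectrum.asIdeal (hw₀ v)).symm⟩) hdat P
      fun v hv => hv1 v (hP v hv)
  have hfin : {v | v ∉ Exc ∧ dat (w₀ v) ≠ 1}.Finite := by
    refine (finite_setOf_natCast_mem k E.absDisc_pos.ne').subset fun v hv => ?_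
    have h1 := hdvd {v} (by simpa using hv.1)
    rw [Finset.prod_singleton] at h1
    have h2 : 0 < ind A (dat (w₀ v)) := (minInd_pos A).trans_le (minInd_le_ind hv.2)
    obtain ⟨c, hc⟩ := (dvd_pow_self _ h2.ne').trans h1
    rw [Set.mem_ofPred_eq, hc, Nat.cast_mul]
    exact v.asIdeal.mul_mem_right _ (Ideal.absNorm_mem _)
  have hmem : ∀ v, v ∈ hfin.toFinset ↔ v ∉ Exc ∧ dat (w₀ v) ≠ 1 := by simp
  obtain ⟨x, y, h1, h2, h3, h4⟩ := exists_code (cl := inertiaType k A)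
    (o := MinOrbit.rep (k := k)) (dat := dat) (w₀ := w₀)
    (π := fun b => b.under (𝓞 k)) (ρ := fun b => b.under (𝓞 K))
    (NV := fun v => Ideal.absNorm v.asIdeal) (NU := fun v => Ideal.absNorm v.asIdeal)
    (e := ind A) (a := minInd A)
    (fun b b' h => by
      have := congrArg (HeightOneSpectrum.under (𝓞 k)) h
      apply HeightOneSpectrum.ext
      simpa [HeightOneSpectrum.ext_iff, Ideal.under_under] using this)
    (fun v S h => by
      obtain ⟨w, hw, hw'⟩ := hd.exists_of_cycRel hζ (cycRel_rep_of_inertiaType_eq_inl h)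
      exact ⟨w, hw.trans (hw₀ v), hw'⟩)
    hN (fun v => one_le_two.trans (two_le_absNorm v))
    (fun g S h => (ind_of_inertiaType_eq_inl h).ge)
    (fun g h hg => by
      rw [eq_of_inertiaType_eq_inr hg]
      exact minInd_lt_ind h.2.1 h.2.2) hfin.toFinset
  have hne : ∀ v c, inertiaType k A (dat (w₀ v)) = some c → dat (w₀ v) ≠ 1 := by
    intro v c hc h
    rw [inertiaType_eq_none.2 h] at hc
    cases hc
  refine ⟨x, y, ⟨h1, ?_, ?_⟩, ?_⟩
  · exact fun v hv S hS => h2 v ((hmem v).2 ⟨hv, hne v _ hS⟩) S hS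
  · intro h v
    rw [h3, hmem]
    exact ⟨fun hv => ⟨hv.1.1, hv.2⟩, fun hv => ⟨⟨hv.1, hne v _ hv.2⟩, hv.2⟩⟩
  · refine (Nat.mul_le_mul_left q h4).trans (Nat.le_of_dvd E.absDisc_pos ?_)
    refine Nat.Coprime.mul_dvd_of_dvd_of_dvd ?_ hq (hdvd _ fun v hv => ((hmem v).1 hv).1)
    exact Nat.Coprime.prod_right fun v hv =>
      (coprime_absNorm_of_notMem (hv2 v ((hmem v).1 hv).1)).pow_right _

end

lemma exists_cyclotomic_intermediateField (k : Type*) [Field k] [NumberField k] {n : ℕ}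
    (hn : n ≠ 0) : ∃ (F : IntermediateField k (AlgebraicClosure k)) (ζ : Fˣ),
      NumberField F ∧ IsGalois k F ∧ IsPrimitiveRoot ζ n ∧
        F = IntermediateField.adjoin k {((ζ : F) : AlgebraicClosure k)} := by
  have : NeZero n := ⟨hn⟩
  have : NeZero (n : AlgebraicClosure k) := ⟨by exact_mod_cast hn⟩
  obtain ⟨z, hz⟩ := HasEnoughRootsOfUnity.exists_primitiveRoot (AlgebraicClosure k) n
  have hcyc := hz.intermediateField_adjoin_isCyclotomicExtension k
  have : NumberField (IntermediateField.adjoin k {z}) :=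
    have := IsCyclotomicExtension.finiteDimensional {n} k (IntermediateField.adjoin k {z})
    NumberField.of_module_finite k _
  have : IsGalois k (IntermediateField.adjoin k {z}) := IsCyclotomicExtension.isGalois {n} k _
  let z' : IntermediateField.adjoin k {z} := ⟨z, IntermediateField.mem_adjoin_simple_self k z⟩
  have hz' : IsPrimitiveRoot z' n := hz.of_map_of_injective
    (f := algebraMap (IntermediateField.adjoin k {z}) (AlgebraicClosure k))
    (FaithfulSMul.algebraMap_injective _ _)
  refine ⟨IntermediateField.adjoin k {z}, (hz'.isUnit hn).unit, inferInstance,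
    inferInstance, ?_, ?_⟩
  · exact IsPrimitiveRoot.coe_units_iff.1 hz'
  · rfl

lemma mul_rpow_le_rpow_div {a : ℕ} (ha : 0 < a) {x y q X : ℝ} (hx : 0 ≤ x) (hy : 0 ≤ y)
    (hq : 0 < q) (h : q * (x ^ a * y ^ (a + 1)) ≤ X) :
    x * y ^ (1 + 1 / (a : ℝ)) ≤ (X / q) ^ (1 / (a : ℝ)) := by
  have ha' : (a : ℝ) ≠ 0 := by positivity
  have h1 : x ^ a * y ^ (a + 1) ≤ X / q := by rwa [le_div_iff₀' hq]
  have h2 : x * y ^ (1 + 1 / (a : ℝ)) = (x ^ a * y ^ (a + 1)) ^ (1 / (a : ℝ)) := by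
    rw [Real.mul_rpow (by positivity) (by positivity), one_div, Real.pow_rpow_inv_natCast hx ha.ne',
      ← Real.rpow_natCast y, ← Real.rpow_mul hy]
    congr 2
    push_cast
    field_simp
  rw [h2]
  exact Real.rpow_le_rpow (by positivity) h1 (by positivity)

lemma logCount_codes (k : Type*) [Field k] [NumberField k] (A : Type*) [CommGroup A] [Fintype A]
    [Nontrivial A] (K : Type*) [Field K] [NumberField K] :
    LogCount (fun p : (MinOrbit k A → Finset (HeightOneSpectrum (𝓞 K))) ×
        (NonMinElement A → Finset (HeightOneSpectrum (𝓞 k))) =>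
      (∏ S, ∏ u ∈ p.1 S, (Ideal.absNorm u.asIdeal : ℝ)) *
        ∏ h, (∏ v ∈ p.2 h, (Ideal.absNorm v.asIdeal : ℝ)) ^ (1 + 1 / (minInd A : ℝ)))
      (bkA k A - 1) := by
  have : Nonempty (MinOrbit k A) := by
    obtain ⟨g, hg, hg'⟩ := exists_ind_eq_minInd A
    exact ⟨_, g, hg, hg', rfl⟩
  have ha := minInd_pos A
  refine (LogCount.pi (logCount_primeSets K)).prod_pi_rpow (logCount_primeSets k) ?_
  rw [lt_add_iff_pos_right]
  positivity

lemma one_add_log_le {Z X : ℝ} (hZ : 1 ≤ Z) (hZX : Z ≤ X) (hX : 2 ≤ X) :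
    1 + Real.log Z ≤ (1 + 1 / Real.log 2) * Real.log X := by
  have h2 : 0 < Real.log 2 := Real.log_pos one_lt_two
  have h3 : Real.log Z ≤ Real.log X := Real.log_le_log (by linarith) hZX
  have h4 : Real.log 2 ≤ Real.log X := Real.log_le_log two_pos hX
  have h5 : 1 ≤ 1 / Real.log 2 * Real.log X := by
    rw [one_div_mul_eq_div, le_div_iff₀ h2]
    linarith
  linarith

lemma card_pow_ncard_le (k : Type*) [Field k] [NumberField k] {B n q : ℕ} (hB : 0 < B)
    (hn : n ≠ 0) (hq : q ≠ 0) :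
    B ^ {v : HeightOneSpectrum (𝓞 k) | ((n * q : ℕ) : 𝓞 k) ∈ v.asIdeal}.ncard ≤
      B ^ (Module.finrank ℚ k * n.primeFactors.card) *
        (B ^ Module.finrank ℚ k) ^ q.primeFactors.card := by
  rw [← pow_mul, ← pow_add, ← mul_add]
  refine Nat.pow_le_pow_right hB ((ncard_setOf_natCast_mem_le k (mul_ne_zero hn hq)).trans ?_)
  rw [Nat.primeFactors_mul hn hq]
  exact Nat.mul_le_mul_left _ (Finset.card_union_le _ _)

lemma main_estimate {c₀ c B M Z X Q : ℝ} {b : ℕ} (hc₀ : 0 ≤ c₀) (hc : 0 ≤ c) (hB : B ≤ M)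
    (hM : 0 ≤ M) (hZ : 1 ≤ Z) (hZQ : Z = Q) (hZX : Z ≤ X) (hX : 2 ≤ X) :
    c₀ * (B * (c * Z * (1 + Real.log Z) ^ b)) ≤
      c₀ * M * c * (1 + 1 / Real.log 2) ^ b * Q * Real.log X ^ b := by
  have h1 := one_add_log_le hZ hZX hX
  have h2 := Real.log_nonneg hZ
  calc c₀ * (B * (c * Z * (1 + Real.log Z) ^ b))
      ≤ c₀ * (M * (c * Z * ((1 + 1 / Real.log 2) * Real.log X) ^ b)) := by gcongr
    _ = _ := by
      rw [← hZQ, mul_pow]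
      ring

/-- `A`-extensions are counted by finitely many choices, local data at an exceptional set of
primes, and codes of bounded weight. -/
lemma exists_card_le (k : Type*) [Field k] [NumberField k] (A : Type*) [CommGroup A] [Fintype A]
    [Nontrivial A] : ∃ c₀ c : ℝ, 0 < c₀ ∧ 0 < c ∧ ∀ q : ℕ, 0 < q → ∀ X : ℝ,
      ({E : AExtension k A | (absDisc k E.L : ℝ) ≤ X ∧ q ∣ absDisc k E.L}).Nonempty →
      1 ≤ (X / q) ^ (1 / (minInd A : ℝ)) ∧
      (Nat.card {E : AExtension k A // (absDisc k E.L : ℝ) ≤ X ∧ q ∣ absDisc k E.L} : ℝ) ≤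
        c₀ * ((Fintype.card A : ℝ) ^ {v : HeightOneSpectrum (𝓞 k) |
            ((Monoid.exponent A * q : ℕ) : 𝓞 k) ∈ v.asIdeal}.ncard *
          (c * (X / q) ^ (1 / (minInd A : ℝ)) *
            (1 + Real.log ((X / q) ^ (1 / (minInd A : ℝ)))) ^ (bkA k A - 1))) := by
  have hn : Monoid.exponent A ≠ 0 := Monoid.exponent_ne_zero_of_finite
  obtain ⟨F, ζ, hNF, hGal, hζ, hF⟩ := exists_cyclotomic_intermediateField k hn
  obtain ⟨g₀, hg₀, hg₀'⟩ := exists_ind_eq_minInd A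
  obtain ⟨K, hK1, hK2⟩ := exists_intermediateField_of_orderOf (k := k) hζ
    (Monoid.order_dvd_exponent g₀)
  have hrep : ∀ S : MinOrbit k A, orderOf S.rep = orderOf g₀ := fun S =>
    orderOf_eq_of_ind_eq (S.ind_rep.trans hg₀'.symm)
  have hw : ∀ v : HeightOneSpectrum (𝓞 k), ∃ w : HeightOneSpectrum (𝓞 F), w.under (𝓞 k) = v := by
    intro v
    obtain ⟨w, hw⟩ := (inferInstance : Nonempty (v.asIdeal.primesOver (𝓞 F)))
    have h1 := hw.1
    have h2 := hw.2
    exact ⟨⟨w, h1, Ideal.ne_bot_of_liesOver_of_ne_bot v.ne_bot w⟩,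
      HeightOneSpectrum.ext h2.over.symm⟩
  choose w₀ hw₀ using hw
  have hgen : ∀ (E : AExtension k A) (χ : A →* Fˣ),
      ∃ c, IsKummerGen (Monoid.exponent A) E.toHom χ c := by
    intro E χ
    obtain ⟨a, ha, -⟩ := E.exists_isResolvent χ
    obtain ⟨c, hc, -⟩ := ha.exists_isKummerGen fun g => Monoid.pow_exponent_eq_one g
    exact ⟨c, hc⟩
  choose dat hdat using fun (E : AExtension k A) v => exists_isLocalDatum hζ (hgen E) v
  have heq : ∀ E, IsEquivariant k ζ (dat E) := fun E τ v w u hw hu =>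
    IsLocalDatum.map hζ (hgen E) (hdat E v) (hdat E w) τ hw hu
  obtain ⟨R, Φ, hΦ⟩ := AExtension.exists_finite_injOn_fibers hζ hdat
  let W : (MinOrbit k A → Finset (HeightOneSpectrum (𝓞 K))) ×
      (NonMinElement A → Finset (HeightOneSpectrum (𝓞 k))) → ℝ := fun p =>
    (∏ S, ∏ u ∈ p.1 S, (Ideal.absNorm u.asIdeal : ℝ)) *
      ∏ h, (∏ v ∈ p.2 h, (Ideal.absNorm v.asIdeal : ℝ)) ^ (1 + 1 / (minInd A : ℝ))
  obtain ⟨hW, c, hc, hcount⟩ : LogCount W (bkA k A - 1) := logCount_codes k A K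
  have : Finite (A →* Fˣ) := by
    have : NeZero (Monoid.exponent A) := ⟨hn⟩
    have := hasEnoughRootsOfUnity_of_isPrimitiveRoot hζ
    exact Finite.of_equiv _
      (CommGroup.monoidHom_mulEquiv_of_hasEnoughRootsOfUnity A F).some.symm.toEquiv
  have : FiniteDimensional k F := inferInstance
  refine ⟨Nat.card (((A →* Fˣ) → R) × ((F ≃ₐ[k] F) → A)) + 1, c, by positivity, hc, ?_⟩
  intro q hq X hne
  set Z := (X / q) ^ (1 / (minInd A : ℝ)) with hZ
  set Exc := {v : HeightOneSpectrum (𝓞 k) | ((Monoid.exponent A * q : ℕ) : 𝓞 k) ∈ v.asIdeal}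
  have hExc : Exc.Finite := finite_setOf_natCast_mem k (mul_ne_zero hn hq.ne')
  have hcode : ∀ E : {E : AExtension k A // (absDisc k E.L : ℝ) ≤ X ∧ q ∣ absDisc k E.L},
      ∃ p : (MinOrbit k A → Finset (HeightOneSpectrum (𝓞 K))) ×
        (NonMinElement A → Finset (HeightOneSpectrum (𝓞 k))),
        IsCode w₀ Exc (dat E) p.1 p.2 ∧ W p ≤ Z := by
    rintro ⟨E, hE, hqE⟩
    obtain ⟨x, y, hxy, hle⟩ := E.exists_isCode (K := K) hζ hF
      (fun b S hb => hK1 _ (heq E) b (by rw [hb, hrep])) hw₀ (heq E) (hdat E) hqE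
    refine ⟨(x, y), hxy, ?_⟩
    simp only [W]
    rw [Real.finsetProd_rpow _ _ (fun h _ => by positivity)]
    refine mul_rpow_le_rpow_div (minInd_pos A) (by positivity) (by positivity)
      (by exact_mod_cast hq) (le_trans ?_ hE)
    exact_mod_cast hle
  choose p hp hpZ using hcode
  have hZ1 : 1 ≤ Z := by
    obtain ⟨E, hE⟩ := hne
    exact (hW (p ⟨E, hE⟩)).trans (hpZ ⟨E, hE⟩)
  obtain ⟨hfin, hcard⟩ := hcount Z hZ1
  refine ⟨hZ1, ?_⟩
  have := hfin.to_subtype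
  have := hExc.to_subtype
  let f : {E : AExtension k A // (absDisc k E.L : ℝ) ≤ X ∧ q ∣ absDisc k E.L} →
      (((A →* Fˣ) → R) × ((F ≃ₐ[k] F) → A)) × (Exc → A) × {p | W p ≤ Z} :=
    fun E => (Φ E, fun v => dat E (w₀ v), ⟨p E, hpZ E⟩)
  have hf : Function.Injective f := by
    intro E E' h
    have h1 : Φ E = Φ E' := congrArg Prod.fst h
    have h2 : (fun v : Exc => dat E (w₀ v)) = fun v : Exc => dat E' (w₀ v) :=
      congrArg (fun t => t.2.1) h
    have h3 : p E = p E' := congrArg (fun t => t.2.2.1) h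
    refine Subtype.ext (hΦ _ _ ?_ h1)
    refine IsCode.eq hζ ?_ hw₀ (heq E) (heq E') (hp E) (h3 ▸ hp E') fun v hv => congrFun h2 ⟨v, hv⟩
    intro d d' hd hd' b b' S hb hb' hbb
    rw [hK2 d d' hd hd' b b' (by rw [hb, hrep]) (hb.trans hb'.symm) hbb, hb]
  have hle := Nat.card_le_card_of_injective f hf
  rw [Nat.card_prod, Nat.card_prod (Exc → A), Nat.card_fun (α := Exc), Nat.card_coe_set_eq,
    Nat.card_coe_set_eq, Nat.card_eq_fintype_card (α := A)] at hle
  refine (Nat.cast_le.2 hle).trans ?_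
  generalize Nat.card (((A →* Fˣ) → R) × ((F ≃ₐ[k] F) → A)) = t
  rw [Nat.cast_mul, Nat.cast_mul, Nat.cast_pow]
  gcongr
  linarith

end

/-- **Uniformity estimate for abelian extensions** (Theorem 4.4).  Let `k` be a number
field and `A` a finite abelian group.  There is a constant `C` and an implied constant,
both depending only on `k` and `A` (not on `q`), such that for every positive integer
`q` and `X ≥ 2`, the number `N_q(A, X)` of isomorphism classes of `A`-extensions
`L/k` with `Disc(L) ≤ X` and `q ∣ Disc(L)` satisfies
`N_q(A, X) ≤ O(C^{ω(q)}/q^{1/a(A)}) · X^{1/a(A)} · (ln X)^{b(k,A)-1}`. -/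
theorem abelian_uniformity (k : Type*) [Field k] [NumberField k]
    (A : Type*) [CommGroup A] [Fintype A] [Nontrivial A] :
    ∃ C C' : ℝ, 0 < C ∧ 0 < C' ∧ ∀ q : ℕ, 0 < q → ∀ X : ℝ, 2 ≤ X →
      (Nat.card {E : AExtension k A //
          (absDisc k E.L : ℝ) ≤ X ∧ q ∣ absDisc k E.L} : ℝ)
        ≤ C' * (C ^ q.primeFactors.card / (q : ℝ) ^ (1 / (minInd A : ℝ)))
            * X ^ (1 / (minInd A : ℝ)) * Real.log X ^ (bkA k A - 1) := by
  obtain ⟨c₀, c, hc₀, hc, h⟩ := exists_card_le k A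
  have hn : Monoid.exponent A ≠ 0 := Monoid.exponent_ne_zero_of_finite
  have hA : 0 < Fintype.card A := Fintype.card_pos
  have hlog : 0 < Real.log 2 := Real.log_pos one_lt_two
  refine ⟨(Fintype.card A : ℝ) ^ Module.finrank ℚ k,
    c₀ * (Fintype.card A : ℝ) ^ (Module.finrank ℚ k * (Monoid.exponent A).primeFactors.card) * c *
      (1 + 1 / Real.log 2) ^ (bkA k A - 1), by positivity, by positivity, ?_⟩
  intro q hq X hX
  have hlogX : 0 ≤ Real.log X := Real.log_nonneg (by linarith)
  have hq1 : (1 : ℝ) ≤ q := by exact_mod_cast hq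
  rcases Set.eq_empty_or_nonempty
    {E : AExtension k A | (absDisc k E.L : ℝ) ≤ X ∧ q ∣ absDisc k E.L} with h0 | hne
  · have : IsEmpty {E : AExtension k A // (absDisc k E.L : ℝ) ≤ X ∧ q ∣ absDisc k E.L} :=
      ⟨fun E => h0.subset E.2⟩
    rw [Nat.card_of_isEmpty, Nat.cast_zero]
    positivity
  obtain ⟨hZ, hle⟩ := h q hq X hne
  have hM : (Fintype.card A : ℝ) ^ {v : IsDedekindDomain.HeightOneSpectrum (𝓞 k) |
      ((Monoid.exponent A * q : ℕ) : 𝓞 k) ∈ v.asIdeal}.ncard ≤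
      (Fintype.card A : ℝ) ^ (Module.finrank ℚ k * (Monoid.exponent A).primeFactors.card) *
        ((Fintype.card A : ℝ) ^ Module.finrank ℚ k) ^ q.primeFactors.card := by
    exact_mod_cast card_pow_ncard_le k hA hn hq.ne'
  refine hle.trans ((main_estimate hc₀.le hc.le hM (by positivity) hZ
    (Real.div_rpow (by linarith) (by linarith) _) ?_ hX).trans_eq ?_)
  · have h1 : (X / q) ^ (1 / (minInd A : ℝ)) ≤ X ^ (1 / (minInd A : ℝ)) :=
      Real.rpow_le_rpow (by positivity) (div_le_self (by linarith) hq1) (by positivity)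
    refine h1.trans (Real.rpow_le_self_of_one_le (by linarith) ?_)
    have : (1 : ℝ) ≤ minInd A := by exact_mod_cast minInd_pos A
    rw [div_le_one (by linarith)]
    exact this
  · ring
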